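/- arXiv:1506.06624 — 3 statements merged into one kernel-verified Lean document; each statement's English description precedes it below -/
import Mathlib

section
/- Every Lévy process X (continuous in probability) admits a càdlàg modification Y adapted to the completed natural filtration: Y is right-continuous with left limits and P(X_t ≠ Y_t) = 0 for all t. -/
open MeasureTheory ProbabilityTheory Complex Filter Topology
open scoped RealInnerProductSpace

noncomputable section

/-- An `ℝⁿ`-valued Lévy process: `X₀ = 0` a.s., stationary increments that are
independent of the past, and continuity in probability. -/
structure IsLevyProcess {Ω : Type*} [MeasurableSpace Ω] (P : Measure Ω) {n : ℕ}
    (X : ℝ → Ω → EuclideanSpace ℝ (Fin n)) : Prop where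
  isProb : IsProbabilityMeasure P
  meas : ∀ t : ℝ, Measurable (X t)
  init : ∀ᵐ ω ∂P, X 0 ω = 0
  indep : ∀ s t : ℝ, 0 ≤ s → 0 ≤ t →
    IndepFun (fun ω => X (t + s) ω - X t ω)
      (fun ω => (fun r : {r : ℝ // 0 ≤ r ∧ r ≤ t} => X r ω)) P
  stat : ∀ s t : ℝ, 0 ≤ s → 0 ≤ t →
    Measure.map (fun ω => X (t + s) ω - X t ω) P = Measure.map (X s) P
  contProb : ∀ t : ℝ, 0 ≤ t → ∀ ε : ℝ, 0 < ε →
    Tendsto (fun s : ℝ => P {ω | ε ≤ ‖X s ω - X t ω‖}) (𝓝[Set.Ici 0] t) (𝓝 0)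

/-- The characteristic function `φ_t(u) = E[exp(i⟨u, X_t⟩)]`. -/
def charFn {Ω : Type*} [MeasurableSpace Ω] (P : Measure Ω) {n : ℕ}
    (X : ℝ → Ω → EuclideanSpace ℝ (Fin n)) (t : ℝ) (u : EuclideanSpace ℝ (Fin n)) : ℂ :=
  ∫ ω, Complex.exp (Complex.I * (⟪u, X t ω⟫ : ℝ)) ∂P


/-- The natural filtration of `X` completed by all `P`-null sets. -/
def completedNatFiltration {Ω : Type*} [MeasurableSpace Ω] (P : Measure Ω) {n : ℕ}
    (X : ℝ → Ω → EuclideanSpace ℝ (Fin n)) (t : ℝ) : MeasurableSpace Ω :=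
  (⨆ s ∈ Set.Icc (0 : ℝ) t, MeasurableSpace.comap (X s) inferInstance) ⊔
    MeasurableSpace.generateFrom {A : Set Ω | P A = 0}

section Oscillation

variable {E : Type*} [NormedAddCommGroup E]

/-- `Osc f ε T p t` says that `f` has at least `p` successive oscillations of size `ε` along
points of `T` that are at most `t`. -/
def Osc (f : ℝ → E) (ε : ℝ) (T : Set ℝ) : ℕ → ℝ → Prop
  | 0, _ => True
  | p + 1, t => ∃ s ∈ T, ∃ u ∈ T, s < u ∧ u ≤ t ∧ Osc f ε T p s ∧ ε ≤ ‖f u - f s‖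

variable {f : ℝ → E} {ε : ℝ} {S T : Set ℝ}

lemma Osc.mono_time {p : ℕ} {s t : ℝ} (h : Osc f ε T p s) (hst : s ≤ t) : Osc f ε T p t := by
  cases p with
  | zero => trivial
  | succ p =>
    obtain ⟨a, ha, b, hb, hab, hbs, h⟩ := h
    exact ⟨a, ha, b, hb, hab, hbs.trans hst, h⟩

lemma Osc.mono_set (hST : S ⊆ T) {p : ℕ} {t : ℝ} (h : Osc f ε S p t) : Osc f ε T p t := by
  induction p generalizing t with
  | zero => trivial
  | succ p ih =>
    obtain ⟨a, ha, b, hb, hab, hbs, h, h'⟩ := h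
    exact ⟨a, hST ha, b, hST hb, hab, hbs, ih h, h'⟩

lemma Osc.cons (hST : S ⊆ T) {p : ℕ} {s u t : ℝ} (hs : s ∈ T) (hu : u ∈ T) (hsu : s < u)
    (hε : ε ≤ ‖f u - f s‖) (hS : ∀ r ∈ S, u ≤ r) (hut : u ≤ t) (h : Osc f ε S p t) :
    Osc f ε T (p + 1) t := by
  induction p generalizing t with
  | zero => exact ⟨s, hs, u, hu, hsu, hut, trivial, hε⟩
  | succ p ih =>
    obtain ⟨a, ha, b, hb, hab, hbs, h, h'⟩ := h
    exact ⟨a, hST ha, b, hST hb, hab, hbs, ih (hS a ha) h, h'⟩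

/-- Few oscillations imply small oscillation on the left of each point. -/
lemma exists_small_osc_left (hε : 0 < ε) {t b : ℝ} (htb : t ≤ b) {p : ℕ}
    (hp : ¬ Osc f ε T p b) :
    ∃ r < t, ∀ s ∈ T ∩ Set.Ioo r t, ∀ u ∈ T ∩ Set.Ioo r t, ‖f u - f s‖ < ε := by
  by_contra! hcon
  have hcon' : ∀ r < t, ∃ s ∈ T ∩ Set.Ioo r t, ∃ u ∈ T ∩ Set.Ioo r t,
      s < u ∧ ε ≤ ‖f u - f s‖ := by
    intro r hr
    obtain ⟨s, hs, u, hu, hsu⟩ := hcon r hr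
    rcases lt_trichotomy s u with h | rfl | h
    · exact ⟨s, hs, u, hu, h, hsu⟩
    · simp [hε.not_ge] at hsu
    · exact ⟨u, hu, s, hs, h, by rwa [norm_sub_rev]⟩
  have key : ∀ p : ℕ, ∃ r < t, Osc f ε T p r := by
    intro p
    induction p with
    | zero => exact ⟨t - 1, by linarith, trivial⟩
    | succ p ih =>
      obtain ⟨r, hrt, hr⟩ := ih
      obtain ⟨s, hs, u, hu, h, hsu⟩ := hcon' r hrt
      exact ⟨u, hu.2.2, s, hs.1, u, hu.1, h, le_rfl, hr.mono_time hs.2.1.le, hsu⟩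
  obtain ⟨r, hrt, hr⟩ := key p
  exact hp (hr.mono_time (hrt.le.trans htb))

/-- Few oscillations imply small oscillation on the right of each point. -/
lemma exists_small_osc_right (hε : 0 < ε) {t b : ℝ} (htb : t < b) {p : ℕ}
    (hp : ¬ Osc f ε T p b) :
    ∃ r > t, ∀ s ∈ T ∩ Set.Ioo t r, ∀ u ∈ T ∩ Set.Ioo t r, ‖f u - f s‖ < ε := by
  by_contra! hcon
  have hcon' : ∀ r > t, ∃ s ∈ T ∩ Set.Ioo t r, ∃ u ∈ T ∩ Set.Ioo t r,
      s < u ∧ ε ≤ ‖f u - f s‖ := by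
    intro r hr
    obtain ⟨s, hs, u, hu, hsu⟩ := hcon r hr
    rcases lt_trichotomy s u with h | rfl | h
    · exact ⟨s, hs, u, hu, h, hsu⟩
    · simp [hε.not_ge] at hsu
    · exact ⟨u, hu, s, hs, h, by rwa [norm_sub_rev]⟩
  have key : ∀ p : ℕ, ∃ r, t < r ∧ r ≤ b ∧ Osc f ε (T ∩ Set.Ici r) p b := by
    intro p
    induction p with
    | zero => exact ⟨b, htb, le_rfl, trivial⟩
    | succ p ih =>
      obtain ⟨r, hrt, hrb, hr⟩ := ih
      obtain ⟨s, hs, u, hu, h, hsu⟩ := hcon' r hrt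
      refine ⟨s, hs.2.1, hs.2.2.le.trans hrb, hr.cons ?_ ⟨hs.1, Set.mem_Ici.2 le_rfl⟩
        ⟨hu.1, Set.mem_Ici.2 h.le⟩ h hsu ?_ (hu.2.2.le.trans hrb)⟩
      · exact Set.inter_subset_inter_right _ (Set.Ici_subset_Ici.2 hs.2.2.le)
      · exact fun v hv => hu.2.2.le.trans hv.2
  obtain ⟨r, -, -, hr⟩ := key p
  exact hp (hr.mono_set Set.inter_subset_left)

lemma exists_tendsto_of_small_osc [CompleteSpace E] {l : Filter ℝ} [l.NeBot]
    (h : ∀ k : ℕ, ∃ V ∈ l, ∀ s ∈ V, ∀ u ∈ V, ‖f u - f s‖ < 1 / ((k : ℝ) + 1)) :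
    ∃ L, Tendsto f l (𝓝 L) := by
  refine cauchy_map_iff_exists_tendsto.1 (Metric.cauchy_iff.2 ⟨inferInstance, fun δ hδ => ?_⟩)
  obtain ⟨k, hk⟩ := exists_nat_one_div_lt hδ
  obtain ⟨V, hV, hVk⟩ := h k
  refine ⟨f '' V, image_mem_map hV, ?_⟩
  rintro _ ⟨s, hs, rfl⟩ _ ⟨u, hu, rfl⟩
  rw [dist_eq_norm]
  exact (hVk u hu s hs).trans hk

/-- If `g` is the right limit of `f` along a set `D`, then limits of `f` along `D ∩ U`
are limits of `g` along `U`. -/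
lemma tendsto_of_rightLim {g : ℝ → E} {D U : Set ℝ} {t : ℝ} {L : E} (hU : IsOpen U)
    (hD : ∀ s ∈ U, (𝓝[D ∩ Set.Ioi s] s).NeBot)
    (hg : ∀ s ∈ U, Tendsto f (𝓝[D ∩ Set.Ioi s] s) (𝓝 (g s)))
    (hf : Tendsto f (𝓝[D ∩ U] t) (𝓝 L)) : Tendsto g (𝓝[U] t) (𝓝 L) := by
  refine (Metric.nhds_basis_closedBall.tendsto_right_iff).2 fun δ hδ => ?_
  have h1 := hf (Metric.closedBall_mem_nhds L hδ)
  obtain ⟨V, hV, htV, hVs⟩ := mem_nhdsWithin.1 h1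
  filter_upwards [inter_mem_nhdsWithin U (hV.mem_nhds htV)] with s hs
  have := hD s hs.1
  refine Metric.isClosed_closedBall.mem_of_tendsto (hg s hs.1) ?_
  have h2 : V ∩ U ∈ 𝓝 s := (hV.inter hU).mem_nhds ⟨hs.2, hs.1⟩
  filter_upwards [self_mem_nhdsWithin, mem_nhdsWithin_of_mem_nhds h2] with q hq hq'
  exact hVs ⟨hq'.1, hq.1, hq'.2⟩

end Oscillation

section MaximalInequality

open scoped ENNReal

variable {Ω : Type*} {m : MeasurableSpace Ω} {P : Measure Ω} {𝒢 : Filtration ℝ m}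

/-- If at each time the event `H t` has conditional probability at most `β` given the past, then
so does the event `H` evaluated at the first time at which the adapted event `A` occurs. -/
lemma measure_le_of_first_time {F : Finset ℝ} {A H : ℝ → Set Ω} {β : ℝ≥0∞} {B : Set Ω}
    (hA : ∀ t ∈ F, MeasurableSet[𝒢 t] (A t))
    (hH : ∀ t ∈ F, ∀ C, MeasurableSet[𝒢 t] C → C ⊆ A t → P (C ∩ H t) ≤ β * P C)
    (hBA : B ⊆ ⋃ t ∈ F, A t)
    (hB : ∀ ω ∈ B, ∀ t ∈ F, ω ∈ A t → (∀ s ∈ F, s < t → ω ∉ A s) → ω ∈ H t) :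
    P B ≤ β * P (⋃ t ∈ F, A t) := by
  classical
  set A' : ℝ → Set Ω := fun t => A t \ ⋃ s ∈ F.filter (· < t), A s with hA'
  have hA'm : ∀ t ∈ F, MeasurableSet[𝒢 t] (A' t) := by
    intro t ht
    refine (hA t ht).diff (Finset.measurableSet_biUnion _ fun s hs => ?_)
    rw [Finset.mem_filter] at hs
    exact 𝒢.mono hs.2.le _ (hA s hs.1)
  have hdisj : (F : Set ℝ).PairwiseDisjoint A' := by
    have aux : ∀ s ∈ F, ∀ t, s < t → Disjoint (A' s) (A' t) := by
      intro s hs t hst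
      rw [Set.disjoint_left]
      intro ω h1 h2
      exact h2.2 (Set.mem_biUnion (by simpa [hst] using hs) h1.1)
    intro s hs t ht hst
    rcases hst.lt_or_gt with h | h
    · exact aux s hs t h
    · exact (aux t ht s h).symm
  have hcover : B ⊆ ⋃ t ∈ F, A' t ∩ H t := by
    intro ω hω
    have hne : (F.filter fun t => ω ∈ A t).Nonempty := by
      obtain ⟨t, ht, h⟩ := Set.mem_iUnion₂.1 (hBA hω)
      exact ⟨t, by simp [ht, h]⟩
    have h1 := Finset.min'_mem _ hne
    have h2 : ∀ s ∈ F, s < (F.filter fun t => ω ∈ A t).min' hne → ω ∉ A s := by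
      intro s hs hlt hωs
      exact absurd (Finset.min'_le _ s (by simp [hs, hωs])) hlt.not_ge
    generalize (F.filter fun t => ω ∈ A t).min' hne = t at h1 h2
    rw [Finset.mem_filter] at h1
    refine Set.mem_biUnion h1.1 ⟨⟨h1.2, ?_⟩, hB ω hω t h1.1 h1.2 h2⟩
    simp only [Set.mem_iUnion, Finset.mem_filter, not_exists]
    exact fun s hs => h2 s hs.1 hs.2
  calc P B ≤ P (⋃ t ∈ F, A' t ∩ H t) := measure_mono hcover
    _ ≤ ∑ t ∈ F, P (A' t ∩ H t) := measure_biUnion_finset_le _ _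
    _ ≤ ∑ t ∈ F, β * P (A' t) :=
        Finset.sum_le_sum fun t ht => hH t ht _ (hA'm t ht) Set.sdiff_subset
    _ = β * P (⋃ t ∈ F, A' t) := by
        rw [← Finset.mul_sum,
          measure_biUnion_finset hdisj fun t ht => 𝒢.le t _ (hA'm t ht)]
    _ ≤ β * P (⋃ t ∈ F, A t) := by
        gcongr
        exact Set.sdiff_subset

variable {E : Type*} [NormedAddCommGroup E] [MeasurableSpace E] [BorelSpace E]
  [SecondCountableTopology E] {X : ℝ → Ω → E} {a b ε : ℝ} {α : ℝ≥0∞}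

lemma measurableSet_le_norm_sub {m : MeasurableSpace Ω} {f g : Ω → E} {c : ℝ}
    (hf : Measurable f) (hg : Measurable g) : MeasurableSet {ω | c ≤ ‖f ω - g ω‖} :=
  measurableSet_le measurable_const (hf.sub hg).norm

/-- Ottaviani's maximal inequality, conditionally on the past. -/
lemma measure_inter_exists_le
    (hX : ∀ s ∈ Set.Icc a b, Measurable[𝒢 s] (X s))
    (hα : ∀ s ∈ Set.Icc a b, ∀ C, MeasurableSet[𝒢 s] C →
      P (C ∩ {ω | ε ≤ ‖X b ω - X s ω‖}) ≤ α * P C)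
    {F : Finset ℝ} (hF : ∀ t ∈ F, t ∈ Set.Icc a b) {s : ℝ} (hs : s ∈ Set.Icc a b)
    {C : Set Ω} (hC : MeasurableSet[𝒢 s] C) :
    P (C ∩ {ω | ∃ u ∈ F, s ≤ u ∧ 2 * ε ≤ ‖X u ω - X s ω‖}) ≤ 2 * α * P C := by
  classical
  set D := {ω | ∃ u ∈ F, s ≤ u ∧ 2 * ε ≤ ‖X u ω - X s ω‖}
  set A : ℝ → Set Ω := fun u => C ∩ {ω | 2 * ε ≤ ‖X u ω - X s ω‖}
  have hA : ∀ t ∈ F.filter (s ≤ ·), MeasurableSet[𝒢 t] (A t) := by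
    intro t ht
    rw [Finset.mem_filter] at ht
    refine (𝒢.mono ht.2 _ hC).inter ?_
    have h1 : Measurable[𝒢 t] (X s) := (hX s hs).mono (𝒢.mono ht.2) le_rfl
    have h2 := hX t (hF t ht.1)
    exact measurableSet_le_norm_sub h2 h1
  have hU : (⋃ t ∈ F.filter (s ≤ ·), A t) ⊆ C :=
    Set.iUnion₂_subset fun t _ => Set.inter_subset_left
  have h1 : P ((C ∩ D) \ {ω | ε ≤ ‖X b ω - X s ω‖}) ≤
      α * P (⋃ t ∈ F.filter (s ≤ ·), A t) := by
    refine measure_le_of_first_time (H := fun t => {ω | ε ≤ ‖X b ω - X t ω‖}) hA ?_ ?_ ?_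
    · intro t ht C' hC' _
      exact hα t (hF t (Finset.mem_filter.1 ht).1) C' hC'
    · rintro ω ⟨⟨hωC, u, hu, hsu, h⟩, -⟩
      exact Set.mem_biUnion (by simp [hu, hsu] : u ∈ F.filter (s ≤ ·)) ⟨hωC, h⟩
    · rintro ω ⟨-, hω⟩ t - ⟨-, ht⟩ -
      simp only [Set.mem_ofPred_eq, not_le] at hω ht ⊢
      have := norm_sub_le_norm_sub_add_norm_sub (X t ω) (X b ω) (X s ω)
      rw [norm_sub_rev (X t ω) (X b ω)] at this
      linarith
  calc P (C ∩ D) ≤ P (C ∩ {ω | ε ≤ ‖X b ω - X s ω‖} ∪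
        (C ∩ D) \ {ω | ε ≤ ‖X b ω - X s ω‖}) := by
        refine measure_mono fun ω hω => ?_
        by_cases h : ε ≤ ‖X b ω - X s ω‖
        · exact Or.inl ⟨hω.1, h⟩
        · exact Or.inr ⟨hω, h⟩
    _ ≤ α * P C + α * P C := (measure_union_le _ _).trans
        (add_le_add (hα s hs C hC) (h1.trans (by gcongr)))
    _ = 2 * α * P C := by ring

lemma measurableSet_osc (hX : ∀ s ∈ Set.Icc a b, Measurable[𝒢 s] (X s)) {F : Finset ℝ}
    (hF : ∀ t ∈ F, t ∈ Set.Icc a b) (p : ℕ) (t : ℝ) :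
    MeasurableSet[𝒢 t] {ω | Osc (X · ω) ε F p t} := by
  induction p generalizing t with
  | zero => simp [Osc]
  | succ p ih =>
    have : {ω | Osc (X · ω) ε F (p + 1) t} = ⋃ s ∈ F, ⋃ u ∈ F,
        {ω | s < u ∧ u ≤ t ∧ Osc (X · ω) ε F p s ∧ ε ≤ ‖X u ω - X s ω‖} := by
      ext ω
      simp only [Osc, Finset.mem_coe, Set.mem_ofPred_eq, Set.mem_iUnion, exists_prop]
    rw [this]
    refine Finset.measurableSet_biUnion _ fun s hs => Finset.measurableSet_biUnion _ fun u hu => ?_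
    by_cases h : s < u ∧ u ≤ t
    · simp only [h.1, h.2, true_and]
      have h1 : Measurable[𝒢 t] (X s) :=
        (hX s (hF s hs)).mono (𝒢.mono (h.1.le.trans h.2)) le_rfl
      have h2 : Measurable[𝒢 t] (X u) := (hX u (hF u hu)).mono (𝒢.mono h.2) le_rfl
      exact (𝒢.mono (h.1.le.trans h.2) _ (ih s)).inter (measurableSet_le_norm_sub h2 h1)
    · have : {ω | s < u ∧ u ≤ t ∧ Osc (X · ω) ε F p s ∧ ε ≤ ‖X u ω - X s ω‖} = ∅ := by
        ext ω
        simp only [Set.mem_ofPred_eq, Set.mem_empty_iff_false, iff_false]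
        tauto
      rw [this]
      exact @MeasurableSet.empty _ (𝒢 t)

lemma measure_osc_finset_le [IsProbabilityMeasure P]
    (hX : ∀ s ∈ Set.Icc a b, Measurable[𝒢 s] (X s))
    (hα : ∀ s ∈ Set.Icc a b, ∀ C, MeasurableSet[𝒢 s] C →
      P (C ∩ {ω | ε ≤ ‖X b ω - X s ω‖}) ≤ α * P C)
    {F : Finset ℝ} (hF : ∀ t ∈ F, t ∈ Set.Icc a b) (p : ℕ) :
    P {ω | Osc (X · ω) (4 * ε) F p b} ≤ (2 * α) ^ p := by
  induction p with
  | zero => simp [Osc]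
  | succ p ih =>
    rw [pow_succ']
    refine (measure_le_of_first_time (𝒢 := 𝒢) (F := F)
      (A := fun t => {ω | Osc (X · ω) (4 * ε) F p t})
      (H := fun t => {ω | ∃ u ∈ F, t ≤ u ∧ 2 * ε ≤ ‖X u ω - X t ω‖})
      (fun t _ => measurableSet_osc hX hF p t)
      (fun t ht C hC _ => measure_inter_exists_le hX hα hF (hF t ht) hC) ?_ ?_).trans
      (mul_le_mul_right ((measure_mono ?_).trans ih) _)
    · rintro ω ⟨s, hs, u, hu, -, -, h, -⟩
      exact Set.mem_biUnion hs h
    · rintro ω ⟨s, hs, u, hu, hsu, -, h, hε⟩ t ht - hmin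
      have hts : t ≤ s := not_lt.1 fun hlt => hmin s hs hlt h
      by_contra hcon
      simp only [Set.mem_ofPred_eq, not_exists, not_and, not_le] at hcon
      have h1 := hcon s hs hts
      have h2 := hcon u hu (hts.trans hsu.le)
      have := norm_sub_le_norm_sub_add_norm_sub (X u ω) (X t ω) (X s ω)
      rw [norm_sub_rev (X t ω)] at this
      linarith
    · exact Set.iUnion₂_subset fun t ht ω h => h.mono_time (hF t ht).2

lemma Osc.exists_finset {E : Type*} [NormedAddCommGroup E] {f : ℝ → E} {ε : ℝ} {T : Set ℝ}
    {p : ℕ} {t : ℝ} (h : Osc f ε T p t) :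
    ∃ F : Finset T, Osc f ε (Subtype.val '' (F : Set T)) p t := by
  classical
  induction p generalizing t with
  | zero => exact ⟨∅, trivial⟩
  | succ p ih =>
    obtain ⟨s, hs, u, hu, hsu, hut, h, hε⟩ := h
    obtain ⟨F, hF⟩ := ih h
    refine ⟨insert ⟨s, hs⟩ (insert ⟨u, hu⟩ F), s, by simp [hs], u, by simp [hu], hsu, hut,
      hF.mono_set ?_, hε⟩
    exact Set.image_mono (by simp [Set.subset_def]; tauto)

lemma measure_osc_le [IsProbabilityMeasure P]
    (hX : ∀ s ∈ Set.Icc a b, Measurable[𝒢 s] (X s))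
    (hα : ∀ s ∈ Set.Icc a b, ∀ C, MeasurableSet[𝒢 s] C →
      P (C ∩ {ω | ε ≤ ‖X b ω - X s ω‖}) ≤ α * P C)
    {T : Set ℝ} (hT : T.Countable) (hTab : T ⊆ Set.Icc a b) (p : ℕ) :
    P {ω | Osc (X · ω) (4 * ε) T p b} ≤ (2 * α) ^ p := by
  classical
  have : Countable T := hT
  have hsub : {ω | Osc (X · ω) (4 * ε) T p b} ⊆
      ⋃ F : Finset T, {ω | Osc (X · ω) (4 * ε) (Subtype.val '' (F : Set T)) p b} :=
    fun ω h => Set.mem_iUnion.2 h.exists_finset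
  refine (measure_mono hsub).trans ?_
  rw [Directed.measure_iUnion]
  · refine iSup_le fun F => ?_
    have h := measure_osc_finset_le hX hα (F := F.image Subtype.val) (p := p) ?_
    · rwa [Finset.coe_image] at h
    · intro t ht
      obtain ⟨x, -, rfl⟩ := Finset.mem_image.1 ht
      exact hTab x.2
  · refine Monotone.directed_le fun F G hFG ω h => h.mono_set ?_
    exact Set.image_mono (Finset.coe_subset.2 hFG)

/-- Almost surely, there are finitely many oscillations. -/
lemma ae_exists_not_osc [IsProbabilityMeasure P]
    (hX : ∀ s ∈ Set.Icc a b, Measurable[𝒢 s] (X s))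
    (hα : ∀ s ∈ Set.Icc a b, ∀ C, MeasurableSet[𝒢 s] C →
      P (C ∩ {ω | ε ≤ ‖X b ω - X s ω‖}) ≤ α * P C) (hα1 : 2 * α < 1)
    {T : Set ℝ} (hT : T.Countable) (hTab : T ⊆ Set.Icc a b) :
    ∀ᵐ ω ∂P, ∃ p, ¬ Osc (X · ω) (4 * ε) T p b := by
  rw [ae_iff]
  refine le_antisymm (ge_of_tendsto' (ENNReal.tendsto_pow_atTop_nhds_zero_of_lt_one hα1)
    fun p => (measure_mono fun ω h => ?_).trans (measure_osc_le hX hα hT hTab p)) zero_le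
  simp only [Set.mem_ofPred_eq, not_exists, not_not] at h
  exact h p

end MaximalInequality

lemma neBot_nhdsWithin_dense_inter {D U : Set ℝ} (hD : Dense D) (hU : IsOpen U) {t : ℝ}
    (ht : t ∈ closure U) : (𝓝[D ∩ U] t).NeBot := by
  rw [← mem_closure_iff_nhdsWithin_neBot, Set.inter_comm]
  exact closure_minimal (hD.open_subset_closure_inter hU) isClosed_closure ht

namespace IsLevyProcess

variable {Ω : Type*} [MeasurableSpace Ω] {P : Measure Ω} {n : ℕ}
  {X : ℝ → Ω → EuclideanSpace ℝ (Fin n)}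

/-- The natural filtration of a Lévy process. -/
def filtration (hX : IsLevyProcess P X) : Filtration ℝ ‹MeasurableSpace Ω› where
  seq t := MeasurableSpace.comap
    (fun ω => (fun r : {r : ℝ // 0 ≤ r ∧ r ≤ t} => X r ω)) inferInstance
  mono' s t hst := by
    rintro _ ⟨B, hB, rfl⟩
    have hρ : Measurable (fun (f : {r : ℝ // 0 ≤ r ∧ r ≤ t} → EuclideanSpace ℝ (Fin n))
        (r : {r : ℝ // 0 ≤ r ∧ r ≤ s}) => f ⟨r, r.2.1, r.2.2.trans hst⟩) :=
      measurable_pi_lambda _ fun r => measurable_pi_apply _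
    exact ⟨_, hρ hB, rfl⟩
  le' t := by
    rw [← measurable_iff_comap_le]
    exact measurable_pi_lambda _ fun r => hX.meas r

lemma measurable_filtration (hX : IsLevyProcess P X) {t : ℝ} (ht : 0 ≤ t) :
    Measurable[hX.filtration t] (X t) :=
  (measurable_pi_apply (⟨t, ht, le_rfl⟩ : {r : ℝ // 0 ≤ r ∧ r ≤ t})).comp
    (comap_measurable fun ω => (fun r : {r : ℝ // 0 ≤ r ∧ r ≤ t} => X r ω))

lemma measure_inter_increment (hX : IsLevyProcess P X) {s t ε : ℝ} (hs : 0 ≤ s) (hst : s ≤ t)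
    {C : Set Ω} (hC : MeasurableSet[hX.filtration s] C) :
    P (C ∩ {ω | ε ≤ ‖X t ω - X s ω‖}) = P {ω | ε ≤ ‖X (t - s) ω‖} * P C := by
  obtain ⟨C', hC', rfl⟩ := hC
  have hB : MeasurableSet {x : EuclideanSpace ℝ (Fin n) | ε ≤ ‖x‖} :=
    measurableSet_le measurable_const measurable_norm
  have hts : 0 ≤ t - s := sub_nonneg.2 hst
  have h1 := (hX.indep (t - s) s hts hs).measure_inter_preimage_eq_mul _ _ hB hC'
  have h2 := congrArg (fun μ => μ {x | ε ≤ ‖x‖}) (hX.stat (t - s) s hts hs)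
  rw [Measure.map_apply (f := fun ω => X (s + (t - s)) ω - X s ω)
    ((hX.meas _).sub (hX.meas _)) hB, Measure.map_apply (hX.meas _) hB] at h2
  rw [h2, add_sub_cancel, Set.inter_comm] at h1
  exact h1

lemma exists_small_increment (hX : IsLevyProcess P X) {ε : ℝ} (hε : 0 < ε) {α : ENNReal}
    (hα : 0 < α) : ∃ h > 0, ∀ r ∈ Set.Icc 0 h, P {ω | ε ≤ ‖X r ω‖} ≤ α := by
  have h1 := (hX.contProb 0 le_rfl ε hε).eventually (ge_mem_nhds hα)
  obtain ⟨h, hh, hsub⟩ := mem_nhdsGE_iff_exists_Icc_subset.1 h1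
  refine ⟨h, hh, fun r hr => ?_⟩
  refine le_trans (le_of_eq (measure_congr ?_)) (hsub hr)
  filter_upwards [hX.init] with ω hω
  simp only [Set.ofPred, hω, sub_zero]

/-- A Lévy process has, almost surely, one-sided limits along the rationals. -/
lemma ae_exists_limits (hX : IsLevyProcess P X) {D : Set ℝ} (hD : D.Countable) (hd : Dense D) :
    ∀ᵐ ω ∂P,
      (∀ t, 0 ≤ t → ∃ L, Tendsto (X · ω) (𝓝[D ∩ Set.Ioi t] t) (𝓝 L)) ∧
      (∀ t, 0 < t → ∃ L, Tendsto (X · ω) (𝓝[D ∩ Set.Iio t] t) (𝓝 L)) := by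
  have := hX.isProb
  have hpos : ∀ k : ℕ, 0 < (1 / ((k : ℝ) + 1)) / 4 := fun k => by positivity
  choose h hh0 hh using fun k : ℕ => hX.exists_small_increment (hpos k)
    (α := 1 / 4) (by simp)
  have hα1 : (2 : ENNReal) * (1 / 4) < 1 := by
    rw [← ENNReal.toReal_lt_toReal (by finiteness) (by simp)]
    norm_num
  have key : ∀ᵐ ω ∂P, ∀ k i : ℕ, ∃ p, ¬ Osc (X · ω) (1 / ((k : ℝ) + 1))
      (D ∩ Set.Icc (i * h k) ((i + 1) * h k)) p ((i + 1) * h k) := by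
    rw [ae_all_iff]
    intro k
    rw [ae_all_iff]
    intro i
    have hi : 0 ≤ (i : ℝ) * h k := mul_nonneg i.cast_nonneg (hh0 k).le
    have := ae_exists_not_osc (P := P) (𝒢 := hX.filtration) (X := X) (a := i * h k)
      (b := (i + 1) * h k) (ε := (1 / ((k : ℝ) + 1)) / 4) (α := 1 / 4)
      (T := D ∩ Set.Icc (i * h k) ((i + 1) * h k))
      (fun s hs => hX.measurable_filtration (hi.trans hs.1)) ?_ hα1
      (hD.mono Set.inter_subset_left) Set.inter_subset_right
    · rwa [mul_div_cancel₀ _ (by norm_num : (4 : ℝ) ≠ 0)] at this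
    · intro s hs C hC
      rw [hX.measure_inter_increment (hi.trans hs.1) hs.2 hC]
      gcongr
      refine hh k _ ⟨sub_nonneg.2 hs.2, ?_⟩
      linarith [hs.1]
  filter_upwards [key] with ω hω
  constructor
  · intro t ht
    have := neBot_nhdsWithin_dense_inter hd (U := Set.Ioi t) (t := t) isOpen_Ioi (by simp)
    refine exists_tendsto_of_small_osc fun k => ?_
    set i := ⌊t / h k⌋₊
    have h1 : i * h k ≤ t := (le_div_iff₀ (hh0 k)).1 (Nat.floor_le (div_nonneg ht (hh0 k).le))
    have h2 : t < (i + 1) * h k := (div_lt_iff₀ (hh0 k)).1 (Nat.lt_floor_add_one _)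
    obtain ⟨p, hp⟩ := hω k i
    obtain ⟨r, hr, hosc⟩ := exists_small_osc_right (by positivity) h2 hp
    refine ⟨D ∩ Set.Ioo t (min r ((i + 1) * h k)), ?_, fun s hs u hu => hosc s ?_ u ?_⟩
    · rw [← Set.Ioi_inter_Iio, ← Set.inter_assoc]
      exact inter_mem_nhdsWithin _ (Iio_mem_nhds (lt_min hr h2))
    · have := lt_min_iff.1 hs.2.2
      exact ⟨⟨hs.1, h1.trans hs.2.1.le, this.2.le⟩, hs.2.1, this.1⟩
    · have := lt_min_iff.1 hu.2.2
      exact ⟨⟨hu.1, h1.trans hu.2.1.le, this.2.le⟩, hu.2.1, this.1⟩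
  · intro t ht
    have := neBot_nhdsWithin_dense_inter hd (U := Set.Iio t) (t := t) isOpen_Iio (by simp)
    refine exists_tendsto_of_small_osc fun k => ?_
    obtain ⟨i, hi⟩ : ∃ i : ℕ, ⌈t / h k⌉₊ = i + 1 :=
      Nat.exists_eq_add_one.2 (Nat.ceil_pos.2 (div_pos ht (hh0 k)))
    have h1 : i * h k < t := by
      refine (lt_div_iff₀ (hh0 k)).1 (Nat.lt_ceil.1 ?_)
      omega
    have h2 : t ≤ (i + 1) * h k := by
      refine (div_le_iff₀ (hh0 k)).1 ((Nat.le_ceil _).trans ?_)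
      rw [hi]
      push_cast
      rfl
    obtain ⟨p, hp⟩ := hω k i
    obtain ⟨r, hr, hosc⟩ := exists_small_osc_left (by positivity) h2 hp
    refine ⟨D ∩ Set.Ioo (max r (i * h k)) t, ?_, fun s hs u hu => hosc s ?_ u ?_⟩
    · rw [← Set.Ioi_inter_Iio, Set.inter_comm (Set.Ioi _), ← Set.inter_assoc]
      exact inter_mem_nhdsWithin _ (Ioi_mem_nhds (max_lt hr h1))
    · have := max_lt_iff.1 hs.2.1
      exact ⟨⟨hs.1, this.2.le, hs.2.2.le.trans h2⟩, this.1, hs.2.2⟩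
    · have := max_lt_iff.1 hu.2.1
      exact ⟨⟨hu.1, this.2.le, hu.2.2.le.trans h2⟩, this.1, hu.2.2⟩

/-- A right limit along a dense set is a modification, by continuity in probability. -/
lemma ae_eq_of_tendsto (hX : IsLevyProcess P X) {D : Set ℝ} (hd : Dense D) {t : ℝ} (ht : 0 ≤ t)
    {Z : Ω → EuclideanSpace ℝ (Fin n)}
    (hZ : ∀ᵐ ω ∂P, Tendsto (X · ω) (𝓝[D ∩ Set.Ioi t] t) (𝓝 (Z ω))) : X t =ᵐ[P] Z := by
  have := hX.isProb
  have := neBot_nhdsWithin_dense_inter hd (U := Set.Ioi t) (t := t) isOpen_Ioi (by simp)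
  obtain ⟨q, hq⟩ := (𝓝[D ∩ Set.Ioi t] t).exists_seq_tendsto
  have h1 : TendstoInMeasure P (fun k => X (q k)) atTop (X t) := by
    rw [tendstoInMeasure_iff_norm]
    intro ε hε
    refine (hX.contProb t ht ε hε).comp (hq.mono_right (nhdsWithin_mono _ ?_))
    exact fun s hs => ht.trans (le_of_lt hs.2)
  refine tendstoInMeasure_ae_unique h1 (tendstoInMeasure_of_tendsto_ae
    (fun k => (hX.meas _).aestronglyMeasurable) ?_)
  filter_upwards [hZ] with ω hω
  exact hω.comp hq

end IsLevyProcess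

/-- Completing by null sets preserves measurability under null modifications. -/
lemma measurable_completedNatFiltration {Ω : Type*} [MeasurableSpace Ω] {P : Measure Ω} {n : ℕ}
    {X : ℝ → Ω → EuclideanSpace ℝ (Fin n)} {t : ℝ} (ht : 0 ≤ t)
    {Z : Ω → EuclideanSpace ℝ (Fin n)} (hZ : P {ω | X t ω ≠ Z ω} = 0) :
    Measurable[completedNatFiltration P X t] Z := by
  have hnull : ∀ A, P A = 0 → MeasurableSet[completedNatFiltration P X t] A := fun A hA =>
    (le_sup_right : _ ≤ completedNatFiltration P X t) A
      (MeasurableSpace.measurableSet_generateFrom hA)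
  have hXt : ∀ B, MeasurableSet B → MeasurableSet[completedNatFiltration P X t] (X t ⁻¹' B) :=
    fun B hB => (le_sup_left : _ ≤ completedNatFiltration P X t) _
      (le_iSup₂ (f := fun s (_ : s ∈ Set.Icc (0 : ℝ) t) =>
        MeasurableSpace.comap (X s) inferInstance) t ⟨ht, le_rfl⟩ _ ⟨B, hB, rfl⟩)
  intro B hB
  have : Z ⁻¹' B = (X t ⁻¹' B \ {ω | X t ω ≠ Z ω}) ∪ (Z ⁻¹' B ∩ {ω | X t ω ≠ Z ω}) := by
    ext ω
    by_cases h : X t ω = Z ω <;> simp [h]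
  rw [this]
  exact ((hXt B hB).diff (hnull _ hZ)).union
    (hnull _ (measure_mono_null Set.inter_subset_right hZ))

/-- every Lévy process admits a càdlàg modification adapted to the
completed natural filtration. -/
theorem exists_cadlag_modification {Ω : Type*} [MeasurableSpace Ω] (P : Measure Ω) {n : ℕ}
    (X : ℝ → Ω → EuclideanSpace ℝ (Fin n)) (hX : IsLevyProcess P X) :
    ∃ Y : ℝ → Ω → EuclideanSpace ℝ (Fin n),
      (∀ ω, ∀ t : ℝ, 0 ≤ t → ContinuousWithinAt (fun s => Y s ω) (Set.Ici t) t) ∧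
      (∀ ω, ∀ t : ℝ, 0 < t →
        ∃ L : EuclideanSpace ℝ (Fin n), Tendsto (fun s => Y s ω) (𝓝[Set.Iio t] t) (𝓝 L)) ∧
      (∀ t : ℝ, 0 ≤ t → Measurable[completedNatFiltration P X t] (Y t)) ∧
      (∀ t : ℝ, 0 ≤ t → P {ω | X t ω ≠ Y t ω} = 0) := by
  classical
  set D : Set ℝ := Set.range ((↑) : ℚ → ℝ)
  have hd : Dense D := Rat.denseRange_cast
  have hgood := hX.ae_exists_limits (Set.countable_range _) hd
  set G : Set Ω := {ω | (∀ t, 0 ≤ t → ∃ L, Tendsto (X · ω) (𝓝[D ∩ Set.Ioi t] t) (𝓝 L)) ∧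
    (∀ t, 0 < t → ∃ L, Tendsto (X · ω) (𝓝[D ∩ Set.Iio t] t) (𝓝 L))}
  set Y : ℝ → Ω → EuclideanSpace ℝ (Fin n) := fun t ω =>
    if ω ∈ G then limUnder (𝓝[D ∩ Set.Ioi t] t) (X · ω) else 0
  have hne : ∀ t, (𝓝[D ∩ Set.Ioi t] t).NeBot := fun t =>
    neBot_nhdsWithin_dense_inter hd isOpen_Ioi (by simp)
  have hlim : ∀ ω ∈ G, ∀ t, 0 ≤ t → Tendsto (X · ω) (𝓝[D ∩ Set.Ioi t] t) (𝓝 (Y t ω)) := by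
    intro ω hω t ht
    simp only [Y, if_pos hω]
    exact tendsto_nhds_limUnder (hω.1 t ht)
  have hmod : ∀ t : ℝ, 0 ≤ t → P {ω | X t ω ≠ Y t ω} = 0 := fun t ht =>
    ae_iff.1 (hX.ae_eq_of_tendsto hd ht (hgood.mono fun ω hω => hlim ω hω t ht))
  refine ⟨Y, fun ω t ht => ?_, fun ω t ht => ?_,
    fun t ht => measurable_completedNatFiltration ht (hmod t ht), hmod⟩
  · by_cases hω : ω ∈ G
    · rw [← continuousWithinAt_Ioi_iff_Ici]
      exact tendsto_of_rightLim isOpen_Ioi (fun s _ => hne s)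
        (fun s hs => hlim ω hω s (ht.trans (le_of_lt hs))) (hlim ω hω t ht)
    · simp only [Y, if_neg hω]
      exact continuousWithinAt_const
  · by_cases hω : ω ∈ G
    · obtain ⟨L, hL⟩ := hω.2 t ht
      have hIoo : 𝓝[Set.Iio t] t = 𝓝[Set.Ioo 0 t] t := (nhdsWithin_Ioo_eq_nhdsLT ht).symm
      refine ⟨L, hIoo ▸ tendsto_of_rightLim isOpen_Ioo (fun s _ => hne s)
        (fun s hs => hlim ω hω s hs.1.le) (hL.mono_left (nhdsWithin_mono _ ?_))⟩
      exact Set.inter_subset_inter_right _ Set.Ioo_subset_Iio_self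
    · simp only [Y, if_neg hω]
      exact ⟨0, tendsto_const_nhds⟩
end
end

section
/- A Lévy process whose jump amplitudes are a.s. bounded by M has finite exponential moments: for each t there exists b > 0 with E[exp(b|X_t|)] < ∞; in particular X_t has finite moments of all orders. -/
open MeasureTheory ProbabilityTheory Complex Filter Topology
open scoped RealInnerProductSpace

noncomputable section

/-- If a path on `[0, t]` is right-continuous with left limits and all its jumps are smaller
than `M`, then its oscillation at small scales is smaller than `M + 1`. -/
theorem exists_modulus_of_norm_jump_lt {E : Type*} [NormedAddCommGroup E] {f fm : ℝ → E}
    (hrc : ∀ t : ℝ, 0 ≤ t → ContinuousWithinAt f (Set.Ici t) t)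
    (hll : ∀ t : ℝ, 0 < t → Tendsto f (𝓝[Set.Iio t] t) (𝓝 (fm t)))
    {M : ℝ} (hM : 0 < M) (hjump : ∀ t : ℝ, 0 < t → ‖f t - fm t‖ < M) (t : ℝ) :
    ∃ δ > 0, ∀ u ∈ Set.Icc 0 t, ∀ v ∈ Set.Icc 0 t, dist u v < δ → ‖f u - f v‖ < M + 1 := by
  have key : ∀ x ∈ Set.Icc 0 t, {v | v ∈ Set.Icc 0 t ∧ (x ≤ v → ‖f v - f x‖ < 1 / 2) ∧
      (v < x → ‖f v - fm x‖ < 1 / 2)} ∈ 𝓝[Set.Icc 0 t] x := by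
    intro x hx
    have hr : ∀ᶠ v in 𝓝 x, x ≤ v → ‖f v - f x‖ < 1 / 2 := by
      have := Metric.tendsto_nhds.1 (hrc x hx.1) (1 / 2) (by norm_num)
      simpa [dist_eq_norm] using eventually_nhdsWithin_iff.1 this
    have hl : ∀ᶠ v in 𝓝[Set.Icc 0 t] x, v < x → ‖f v - fm x‖ < 1 / 2 := by
      rcases hx.1.eq_or_lt with rfl | h0
      · filter_upwards [self_mem_nhdsWithin] with v hv hlt using absurd hv.1 (not_le.2 hlt)
      · have := Metric.tendsto_nhds.1 (hll x h0) (1 / 2) (by norm_num)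
        have hev : ∀ᶠ v in 𝓝 x, v < x → ‖f v - fm x‖ < 1 / 2 := by
          simpa [dist_eq_norm] using eventually_nhdsWithin_iff.1 this
        exact mem_nhdsWithin_of_mem_nhds hev
    filter_upwards [self_mem_nhdsWithin, mem_nhdsWithin_of_mem_nhds hr, hl] with v h1 h2 h3
    exact ⟨h1, h2, h3⟩
  obtain ⟨V, hV, hVU⟩ := lebesgue_number_lemma_nhdsWithin' isCompact_Icc key
  obtain ⟨δ, hδ, hδV⟩ := Metric.mem_uniformity_dist.1 hV
  refine ⟨δ, hδ, fun u hu v hv huv => ?_⟩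
  obtain ⟨⟨x, hx⟩, hsub⟩ := hVU u hu
  obtain ⟨-, hur, hul⟩ := hsub ⟨refl_mem_uniformity hV, hu⟩
  obtain ⟨-, hvr, hvl⟩ := hsub ⟨hδV huv, hv⟩
  simp only at hur hul hvr hvl
  have cross : ∀ a b : ℝ, ‖f a - f x‖ < 1 / 2 → ‖f b - fm x‖ < 1 / 2 → b < x → b ∈ Set.Icc 0 t →
      ‖f a - f b‖ < M + 1 := by
    intro a b ha hb hbx hb0
    have hj := hjump x (hb0.1.trans_lt hbx)
    have h : f a - f b = (f a - f x) + (f x - fm x) - (f b - fm x) := by abel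
    rw [h]
    linarith [norm_sub_le ((f a - f x) + (f x - fm x)) (f b - fm x),
      norm_add_le (f a - f x) (f x - fm x)]
  rcases le_or_gt x u with h1 | h1 <;> rcases le_or_gt x v with h2 | h2
  · have := norm_sub_le (f u - f x) (f v - f x)
    rw [sub_sub_sub_cancel_right] at this
    linarith [hur h1, hvr h2]
  · exact cross u v (hur h1) (hvl h2) h2 hv
  · rw [norm_sub_rev]
    exact cross v u (hvr h2) (hul h1) h1 hu
  · have := norm_sub_le (f u - fm x) (f v - fm x)
    rw [sub_sub_sub_cancel_right] at this
    linarith [hul h1, hvl h2]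

/-- A first-passage inequality of Ottaviani type: if the remaining increments of a discrete-time
process are independent of the past and uniformly tight, then its terminal value is unlikely to
exceed a level by much unless one of its steps is large. -/
theorem measureReal_norm_ge_le_of_indep_increments {Ω E : Type*} [MeasurableSpace Ω]
    {P : Measure Ω} [IsProbabilityMeasure P] [NormedAddCommGroup E] [MeasurableSpace E]
    [BorelSpace E] [SecondCountableTopology E] {Y : ℕ → Ω → E} (hY : ∀ k, Measurable (Y k))
    (hY0 : ∀ᵐ ω ∂P, Y 0 ω = 0) {N : ℕ}
    (hind : ∀ k ≤ N, IndepFun (fun ω => Y N ω - Y k ω) (fun ω (i : Set.Iic k) => Y i ω) P)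
    {L : ℝ} (htight : ∀ k ≤ N, P.real {ω | L ≤ ‖Y N ω - Y k ω‖} ≤ 1 / 3)
    (m : ℝ) {r : ℝ} (hr : 0 < r) (hL : 0 < L) (hm : 0 < m) :
    P.real {ω | r + m + L ≤ ‖Y N ω‖} ≤
      P.real {ω | ∃ k < N, m ≤ ‖Y (k + 1) ω - Y k ω‖} + 1 / 2 * P.real {ω | r - L ≤ ‖Y N ω‖} := by
  set F : ℕ → Set Ω := fun k => {ω | r ≤ ‖Y k ω‖ ∧ ∀ i < k, ‖Y i ω‖ < r} with hF
  set G : ℕ → Set Ω := fun k => {ω | L ≤ ‖Y N ω - Y k ω‖} with hG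
  have hFm : ∀ k, MeasurableSet (F k) := by
    intro k
    have : F k = {ω | r ≤ ‖Y k ω‖} ∩ ⋂ i < k, {ω | ‖Y i ω‖ < r} := by
      ext ω; simp [hF]
    rw [this]
    exact (measurableSet_le measurable_const (hY k).norm).inter
      (.iInter fun i => .iInter fun _ => measurableSet_lt (hY i).norm measurable_const)
  have hGm : ∀ k, MeasurableSet (G k) := fun k =>
    measurableSet_le measurable_const ((hY N).sub (hY k)).norm
  have hdisj : Pairwise (Function.onFun Disjoint F) := by
    intro i j hij
    refine Set.disjoint_left.2 fun ω hi hj => ?_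
    rcases hij.lt_or_gt with h | h
    · exact (hj.2 i h).not_ge hi.1
    · exact (hi.2 j h).not_ge hj.1
  have hmul : ∀ k ≤ N, P.real (G k ∩ F k) = P.real (G k) * P.real (F k) := by
    intro k hk
    have h := (hind k hk).measure_inter_preimage_eq_mul {x | L ≤ ‖x‖}
      {y : Set.Iic k → E | r ≤ ‖y ⟨k, Set.mem_Iic.2 le_rfl⟩‖ ∧
        ∀ i : Set.Iic k, (i : ℕ) < k → ‖y i‖ < r}
      (measurableSet_le measurable_const measurable_norm) (by
        refine (measurableSet_le measurable_const (measurable_pi_apply _).norm).inter ?_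
        refine MeasurableSet.congr (.iInter fun i : Set.Iic k => .iInter fun _ : (i : ℕ) < k =>
          measurableSet_lt (measurable_pi_apply i).norm (measurable_const (a := r))) ?_
        ext y
        simp only [Set.mem_iInter]
        rfl)
    have hpre : (fun ω (i : Set.Iic k) => Y i ω) ⁻¹' {y : Set.Iic k → E |
        r ≤ ‖y ⟨k, Set.mem_Iic.2 le_rfl⟩‖ ∧
        ∀ i : Set.Iic k, (i : ℕ) < k → ‖y i‖ < r} = F k := by
      ext ω
      simp only [hF, Set.mem_preimage, Set.mem_ofPred_eq, Subtype.forall, Set.mem_Iic]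
      exact and_congr_right fun _ => ⟨fun h i hi => h i hi.le hi, fun h i _ hi => h i hi⟩
    rw [hpre] at h
    simpa [Measure.real] using congrArg ENNReal.toReal h
  have hcross : P.real {ω | r + m + L ≤ ‖Y N ω‖} ≤
      P.real {ω | ∃ k < N, m ≤ ‖Y (k + 1) ω - Y k ω‖} +
        ∑ k ∈ Finset.range (N + 1), P.real (G k ∩ F k) := by
    refine le_trans ?_ (add_le_add_right (measureReal_biUnion_finset_le _ _) _)
    refine le_trans ?_ (measureReal_union_le _ _)
    refine ENNReal.toReal_mono (measure_ne_top _ _) (measure_mono_ae ?_)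
    filter_upwards [hY0] with ω h0 hω
    change r + m + L ≤ ‖Y N ω‖ at hω
    by_cases hbig : ∃ k < N, m ≤ ‖Y (k + 1) ω - Y k ω‖
    · exact Or.inl hbig
    refine Or.inr ?_
    push Not at hbig
    classical
    have hex : ∃ k, r ≤ ‖Y k ω‖ := ⟨N, by linarith⟩
    have hkN : Nat.find hex ≤ N := Nat.find_min' hex (by linarith)
    obtain ⟨j, hj⟩ : ∃ j, Nat.find hex = j + 1 := by
      refine Nat.exists_eq_succ_of_ne_zero fun h => ?_
      have := Nat.find_spec hex
      rw [h, h0, norm_zero] at this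
      linarith
    have hspec := Nat.find_spec hex
    have hmin : ∀ i < Nat.find hex, ‖Y i ω‖ < r := fun i hi => not_le.1 (Nat.find_min hex hi)
    rw [hj] at hspec hmin hkN
    refine Set.mem_biUnion (x := j + 1) (by simpa using hkN) ⟨?_, hspec, hmin⟩
    change L ≤ ‖Y N ω - Y (j + 1) ω‖
    have h1 := hmin j (Nat.lt_succ_self j)
    have h2 := hbig j hkN
    have h3 := norm_sub_norm_le (Y (j + 1) ω) (Y j ω)
    have h4 := norm_sub_norm_le (Y N ω) (Y (j + 1) ω)
    linarith
  have hstay : ∑ k ∈ Finset.range (N + 1), P.real (F k \ G k) ≤ P.real {ω | r - L ≤ ‖Y N ω‖} := by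
    rw [← measureReal_biUnion_finset
      (fun i _ j _ hij => (hdisj hij).mono Set.sdiff_subset Set.sdiff_subset)
      (fun k _ => (hFm k).diff (hGm k))]
    refine measureReal_mono (Set.iUnion₂_subset fun k _ ω hω => ?_)
    have h1 : r ≤ ‖Y k ω‖ := hω.1.1
    have h2 : ‖Y N ω - Y k ω‖ < L := not_le.1 hω.2
    have h3 := norm_sub_norm_le (Y k ω) (Y N ω)
    rw [norm_sub_rev] at h3
    change r - L ≤ ‖Y N ω‖
    linarith
  have hterm : ∀ k ∈ Finset.range (N + 1),
      P.real (G k ∩ F k) ≤ 1 / 2 * P.real (F k \ G k) := by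
    intro k hk
    have hk' : k ≤ N := by simpa [Nat.lt_succ_iff] using hk
    have h1 := measureReal_inter_add_sdiff (μ := P) (s := F k) (hGm k)
    rw [Set.inter_comm] at h1
    have h2 := hmul k hk'
    have h3 := mul_le_mul_of_nonneg_right (htight k hk') (measureReal_nonneg (μ := P) (s := F k))
    change P.real (G k) * _ ≤ _ at h3
    linarith
  have := Finset.sum_le_sum hterm
  rw [← Finset.mul_sum] at this
  linarith

/-- A random variable whose tail halves over each step of length `K` has an exponential moment. -/
theorem exists_integrable_exp_of_tail_le {Ω : Type*} [MeasurableSpace Ω] {P : Measure Ω}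
    [IsProbabilityMeasure P] {Z : Ω → ℝ} (hZ : Measurable Z) (hZ0 : ∀ ω, 0 ≤ Z ω)
    {K : ℝ} (hK : 0 < K)
    (htail : ∀ r : ℝ, 0 ≤ r → P.real {ω | r + K ≤ Z ω} ≤ 1 / 2 * P.real {ω | r ≤ Z ω}) :
    ∃ b : ℝ, 0 < b ∧ Integrable (fun ω => Real.exp (b * Z ω)) P := by
  have hgeom : ∀ j : ℕ, P.real {ω | j * K ≤ Z ω} ≤ (1 / 2) ^ j := by
    intro j
    induction j with
    | zero => simp
    | succ j ih =>
      have := htail (j * K) (by positivity)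
      rw [show (j : ℝ) * K + K = ((j + 1 : ℕ) : ℝ) * K by push_cast; ring] at this
      rw [pow_succ]
      linarith
  have hlog : 0 < Real.log (3 / 2) := Real.log_pos (by norm_num)
  set b := Real.log (3 / 2) / K with hb
  have hb0 : 0 < b := by positivity
  have hexp : ∀ j : ℕ, Real.exp (b * (j * K)) = (3 / 2) ^ j := by
    intro j
    rw [hb, show Real.log (3 / 2) / K * (j * K) = j * Real.log (3 / 2) by field_simp,
      Real.exp_nat_mul, Real.exp_log (by norm_num)]
  refine ⟨b, hb0, (hZ.const_mul b).exp.aestronglyMeasurable, ?_⟩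
  rw [hasFiniteIntegral_iff_ofReal (ae_of_all _ fun ω => (Real.exp_pos _).le)]
  have hms : ∀ j : ℕ, MeasurableSet {ω | j * K ≤ Z ω} := fun j =>
    measurableSet_le measurable_const hZ
  have hpt : ∀ ω, ENNReal.ofReal (Real.exp (b * Z ω)) ≤ ∑' j : ℕ,
      {ω | (j : ℝ) * K ≤ Z ω}.indicator (fun _ => ENNReal.ofReal ((3 / 2) ^ (j + 1))) ω := by
    intro ω
    refine le_trans ?_ (ENNReal.le_tsum ⌊Z ω / K⌋₊)
    have h1 : (⌊Z ω / K⌋₊ : ℝ) * K ≤ Z ω :=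
      (le_div_iff₀ hK).1 (Nat.floor_le (div_nonneg (hZ0 ω) hK.le))
    have h2 : Z ω < ((⌊Z ω / K⌋₊ + 1 : ℕ) : ℝ) * K := by
      push_cast
      exact (div_lt_iff₀ hK).1 (Nat.lt_floor_add_one _)
    rw [Set.indicator_of_mem (show ω ∈ {ω | _ ≤ Z ω} from h1), ← hexp]
    gcongr
  have hsum : Summable fun j : ℕ => (3 / 2 : ℝ) * (3 / 4) ^ j :=
    (summable_geometric_of_lt_one (by norm_num) (by norm_num)).mul_left _
  calc ∫⁻ ω, ENNReal.ofReal (Real.exp (b * Z ω)) ∂P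
      ≤ ∫⁻ ω, ∑' j : ℕ, {ω | (j : ℝ) * K ≤ Z ω}.indicator
          (fun _ => ENNReal.ofReal ((3 / 2) ^ (j + 1))) ω ∂P := lintegral_mono hpt
    _ = ∑' j : ℕ, ENNReal.ofReal ((3 / 2) ^ (j + 1)) * P {ω | (j : ℝ) * K ≤ Z ω} := by
        rw [lintegral_tsum fun j => (measurable_const.indicator (hms j)).aemeasurable]
        exact tsum_congr fun j => lintegral_indicator_const (hms j) _
    _ ≤ ∑' j : ℕ, ENNReal.ofReal ((3 / 2 : ℝ) * (3 / 4) ^ j) := by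
        refine ENNReal.tsum_le_tsum fun j => ?_
        rw [← ofReal_measureReal, ← ENNReal.ofReal_mul (by positivity)]
        refine ENNReal.ofReal_le_ofReal ((mul_le_mul_of_nonneg_left (hgeom j)
          (by positivity)).trans_eq ?_)
        rw [pow_succ, show (3 / 4 : ℝ) = 3 / 2 * (1 / 2) by norm_num, mul_pow]
        ring
    _ < ⊤ := hsum.tsum_ofReal_lt_top

/-- An exponential moment of a nonnegative random variable bounds all its power moments. -/
theorem integrable_pow_of_integrable_exp_mul {Ω : Type*} [MeasurableSpace Ω] {P : Measure Ω}
    {Z : Ω → ℝ} (hZ : Measurable Z) (hZ0 : ∀ ω, 0 ≤ Z ω) {b : ℝ} (hb : 0 < b)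
    (hint : Integrable (fun ω => Real.exp (b * Z ω)) P) (k : ℕ) :
    Integrable (fun ω => Z ω ^ k) P := by
  refine (hint.const_mul (k.factorial / b ^ k)).mono' (hZ.pow_const k).aestronglyMeasurable
    (ae_of_all _ fun ω => ?_)
  rw [Real.norm_of_nonneg (pow_nonneg (hZ0 ω) k)]
  have h := Real.pow_div_factorial_le_exp _ (mul_nonneg hb.le (hZ0 ω)) k
  rw [mul_pow, div_le_iff₀ (by positivity)] at h
  rw [div_mul_eq_mul_div, le_div_iff₀ (by positivity)]
  linarith

/-- The marginals of a Lévy process are uniformly tight on compact time intervals. -/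
theorem IsLevyProcess.exists_tail_le {Ω : Type*} [MeasurableSpace Ω] {P : Measure Ω} {n : ℕ}
    {X : ℝ → Ω → EuclideanSpace ℝ (Fin n)} (hX : IsLevyProcess P X) (t : ℝ) :
    ∃ L : ℝ, 0 < L ∧ ∀ s ∈ Set.Icc 0 t, P.real {ω | L ≤ ‖X s ω‖} ≤ 1 / 3 := by
  have := hX.isProb
  refine isCompact_Icc.induction_on (p := fun A => ∃ L : ℝ, 0 < L ∧
    ∀ s ∈ A, P.real {ω | L ≤ ‖X s ω‖} ≤ 1 / 3) ⟨1, one_pos, by simp⟩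
    (fun A B hAB ⟨L, h0, h⟩ => ⟨L, h0, fun s hs => h s (hAB hs)⟩) ?_ ?_
  · rintro A B ⟨L₁, h₁, hA⟩ ⟨L₂, h₂, hB⟩
    have hmono : ∀ {a c : ℝ} (s : ℝ), a ≤ c →
        P.real {ω | c ≤ ‖X s ω‖} ≤ P.real {ω | a ≤ ‖X s ω‖} := fun s hac =>
      measureReal_mono (Set.ofPred_subset_ofPred.2 fun ω => hac.trans)
    refine ⟨max L₁ L₂, lt_max_of_lt_left h₁, fun s hs => ?_⟩
    rcases hs with hs | hs
    · exact (hmono s (le_max_left _ _)).trans (hA s hs)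
    · exact (hmono s (le_max_right _ _)).trans (hB s hs)
  · intro u hu
    have hfix : Tendsto (fun j : ℕ => P {ω | (j : ℝ) ≤ ‖X u ω‖}) atTop (𝓝 (P ∅)) := by
      refine tendsto_measure_of_ae_tendsto_indicator_of_isFiniteMeasure atTop .empty
        (fun j => measurableSet_le measurable_const (hX.meas u).norm) (ae_of_all _ fun ω => ?_)
      filter_upwards [tendsto_natCast_atTop_atTop.eventually_gt_atTop ‖X u ω‖] with j hj
      simpa using hj
    rw [measure_empty] at hfix
    have hsix : (0 : ENNReal) < ENNReal.ofReal (1 / 6) := by simp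
    obtain ⟨j, hj⟩ := (hfix.eventually_lt_const hsix).exists
    have hnear := (hX.contProb u hu.1 1 one_pos).eventually_lt_const hsix
    refine ⟨_, nhdsWithin_mono u Set.Icc_subset_Ici_self hnear, j + 1, by positivity,
      fun s hs => ?_⟩
    have hs' : P.real {ω | 1 ≤ ‖X s ω - X u ω‖} ≤ 1 / 6 :=
      ENNReal.toReal_le_of_le_ofReal (by norm_num) (le_of_lt hs)
    have hj' : P.real {ω | (j : ℝ) ≤ ‖X u ω‖} ≤ 1 / 6 :=
      ENNReal.toReal_le_of_le_ofReal (by norm_num) hj.le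
    have hsub : {ω | (j : ℝ) + 1 ≤ ‖X s ω‖} ⊆
        {ω | 1 ≤ ‖X s ω - X u ω‖} ∪ {ω | (j : ℝ) ≤ ‖X u ω‖} := by
      intro ω hω
      change (j : ℝ) + 1 ≤ ‖X s ω‖ at hω
      by_contra hcon
      simp only [Set.mem_union, Set.mem_ofPred_eq, not_or, not_le] at hcon
      linarith [norm_sub_norm_le (X s ω) (X u ω)]
    linarith [(measureReal_mono hsub (μ := P)).trans (measureReal_union_le _ _)]

/-- The tail of a Lévy process with bounded jumps at a fixed time decays geometrically. -/
theorem IsLevyProcess.tail_add_le {Ω : Type*} [MeasurableSpace Ω] {P : Measure Ω} {n : ℕ}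
    {X Xm : ℝ → Ω → EuclideanSpace ℝ (Fin n)} (hX : IsLevyProcess P X)
    (hrc : ∀ ω, ∀ t : ℝ, 0 ≤ t → ContinuousWithinAt (fun s => X s ω) (Set.Ici t) t)
    (hll : ∀ ω, ∀ t : ℝ, 0 < t →
      Tendsto (fun s => X s ω) (𝓝[Set.Iio t] t) (𝓝 (Xm t ω)))
    {M : ℝ} (hM : 0 < M)
    (hjump : P {ω | ∃ t : ℝ, 0 < t ∧ M ≤ ‖X t ω - Xm t ω‖} = 0) {t : ℝ} (ht : 0 ≤ t)
    {L : ℝ} (hL : 0 < L) (htight : ∀ s ∈ Set.Icc 0 t, P.real {ω | L ≤ ‖X s ω‖} ≤ 1 / 3)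
    {r : ℝ} (hr : 0 < r) :
    P.real {ω | r + (M + 1) + L ≤ ‖X t ω‖} ≤ 1 / 2 * P.real {ω | r - L ≤ ‖X t ω‖} := by
  have := hX.isProb
  set τ : ℕ → ℕ → ℝ := fun N k => k * (t / (N + 1)) with hτ
  have hτ0 : ∀ N k, 0 ≤ τ N k := fun N k => by positivity
  have hτN : ∀ N, τ N (N + 1) = t := fun N => by simp only [hτ]; push_cast; field_simp
  have hτmono : ∀ N, Monotone (τ N) := fun N i j hij => by simp only [hτ]; gcongr
  have hτle : ∀ N k, k ≤ N + 1 → τ N k ≤ t := fun N k hk => (hτmono N hk).trans_eq (hτN N)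
  set A : ℕ → Set Ω := fun N =>
    {ω | ∃ k < N + 1, M + 1 ≤ ‖X (τ N (k + 1)) ω - X (τ N k) ω‖} with hA
  have hAm : ∀ N, MeasurableSet (A N) := by
    intro N
    have : A N = ⋃ k < N + 1, {ω | M + 1 ≤ ‖X (τ N (k + 1)) ω - X (τ N k) ω‖} := by
      ext ω; simp [hA]
    rw [this]
    exact .iUnion fun k => .iUnion fun _ =>
      measurableSet_le measurable_const ((hX.meas _).sub (hX.meas _)).norm
  have hAlim : Tendsto (fun N => P (A N)) atTop (𝓝 (P ∅)) := by
    refine tendsto_measure_of_ae_tendsto_indicator_of_isFiniteMeasure atTop .empty hAm ?_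
    filter_upwards [measure_eq_zero_iff_ae_notMem.1 hjump] with ω hω
    have hω' : ∀ s : ℝ, 0 < s → ‖X s ω - Xm s ω‖ < M := fun s hs =>
      not_le.1 fun h => hω ⟨s, hs, h⟩
    obtain ⟨δ, hδ, hmod⟩ := exists_modulus_of_norm_jump_lt (hrc ω) (hll ω) hM hω' t
    have hmesh : Tendsto (fun N : ℕ => t / ((N : ℝ) + 1)) atTop (𝓝 0) :=
      tendsto_const_nhds.div_atTop
        (tendsto_atTop_add_const_right _ _ tendsto_natCast_atTop_atTop)
    filter_upwards [hmesh.eventually_lt_const hδ] with N hN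
    simp only [Set.mem_empty_iff_false, iff_false]
    rintro ⟨k, hk, hle⟩
    refine (hmod _ ⟨hτ0 N _, hτle N _ hk⟩ _ ⟨hτ0 N _, hτle N _ hk.le⟩ ?_).not_ge hle
    have hd : τ N (k + 1) - τ N k = t / (N + 1) := by simp only [hτ]; push_cast; ring
    rwa [Real.dist_eq, hd, abs_of_nonneg (by positivity)]
  rw [measure_empty] at hAlim
  have hAlim' : Tendsto (fun N => P.real (A N)) atTop (𝓝 0) :=
    (ENNReal.tendsto_toReal ENNReal.zero_ne_top).comp hAlim
  have hstep : ∀ N, P.real {ω | r + (M + 1) + L ≤ ‖X t ω‖} ≤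
      P.real (A N) + 1 / 2 * P.real {ω | r - L ≤ ‖X t ω‖} := by
    intro N
    have h := measureReal_norm_ge_le_of_indep_increments (P := P) (Y := fun k => X (τ N k))
      (N := N + 1) (L := L) (r := r) (fun k => hX.meas _) (by simpa [hτ] using hX.init)
      (fun k hk => ?_) (fun k hk => ?_) (M + 1) hr hL (by linarith)
    · simpa only [hτN] using h
    · have hi := hX.indep (t - τ N k) (τ N k) (sub_nonneg.2 (hτle N k hk)) (hτ0 N k)
      rw [add_sub_cancel] at hi
      rw [hτN]
      exact hi.comp (φ := id) (ψ := fun y (i : Set.Iic k) => y ⟨τ N i, hτ0 N i, hτmono N i.2⟩)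
        measurable_id (measurable_pi_lambda _ fun i => measurable_pi_apply _)
    · have hs := hX.stat (t - τ N k) (τ N k) (sub_nonneg.2 (hτle N k hk)) (hτ0 N k)
      rw [add_sub_cancel] at hs
      have hm : MeasurableSet {x : EuclideanSpace ℝ (Fin n) | L ≤ ‖x‖} :=
        measurableSet_le measurable_const measurable_norm
      have h := congrArg (fun μ => μ.real {x | L ≤ ‖x‖}) hs
      rw [map_measureReal_apply (show Measurable fun ω => X t ω - X (τ N k) ω from
          (hX.meas _).sub (hX.meas _)) hm,
        map_measureReal_apply (hX.meas _) hm] at h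
      rw [hτN]
      exact h.trans_le (htight _ ⟨sub_nonneg.2 (hτle N k hk), sub_le_self _ (hτ0 N k)⟩)
  simpa using ge_of_tendsto' (hAlim'.add_const _) hstep

/-- a Lévy process whose jumps are a.s. bounded (in amplitude) by `M`
has finite exponential moments, hence moments of all orders. -/
theorem exp_moments_of_bounded_jumps {Ω : Type*} [MeasurableSpace Ω] (P : Measure Ω) {n : ℕ}
    (X Xm : ℝ → Ω → EuclideanSpace ℝ (Fin n)) (hX : IsLevyProcess P X)
    (hrc : ∀ ω, ∀ t : ℝ, 0 ≤ t → ContinuousWithinAt (fun s => X s ω) (Set.Ici t) t)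
    (hll : ∀ ω, ∀ t : ℝ, 0 < t →
      Tendsto (fun s => X s ω) (𝓝[Set.Iio t] t) (𝓝 (Xm t ω)))
    (M : ℝ) (hM : 0 < M)
    (hjump : P {ω | ∃ t : ℝ, 0 < t ∧ M ≤ ‖X t ω - Xm t ω‖} = 0) :
    ∀ t : ℝ, 0 ≤ t → ∃ b : ℝ, 0 < b ∧
      Integrable (fun ω => Real.exp (b * ‖X t ω‖)) P ∧
      ∀ k : ℕ, Integrable (fun ω => ‖X t ω‖ ^ k) P := by
  intro t ht
  have := hX.isProb
  obtain ⟨L, hL, htight⟩ := hX.exists_tail_le t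
  have hmeas : Measurable fun ω => ‖X t ω‖ := (hX.meas t).norm
  obtain ⟨b, hb, hint⟩ := exists_integrable_exp_of_tail_le (P := P) hmeas
    (fun ω => norm_nonneg _) (K := M + 1 + 2 * L) (by positivity) fun r hr => by
      have h := hX.tail_add_le hrc hll hM hjump ht hL htight (r := r + L) (by linarith)
      rwa [add_sub_cancel_right, show r + L + (M + 1) + L = r + (M + 1 + 2 * L) by ring] at h
  exact ⟨b, hb, hint, integrable_pow_of_integrable_exp_mul hmeas (fun ω => norm_nonneg _) hb hint⟩
end
end

section
/- Let X be a càdlàg Lévy process and B a Borel set with 0 ∉ closure(B). Then the counting process N_t(B) := #{s ≤ t : X_s − X_{s−} ∈ B} is a.s. finite for all t, and (N_t(B))_t is a Poisson process. -/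
open MeasureTheory ProbabilityTheory Complex Filter Topology
open scoped RealInnerProductSpace

noncomputable section

/-- A real-valued Lévy process: `X₀ = 0` a.s., stationary increments independent of
the past, continuity in probability. -/
structure IsLevyR {Ω : Type*} [MeasurableSpace Ω] (P : Measure Ω)
    (X : ℝ → Ω → ℝ) : Prop where
  isProb : IsProbabilityMeasure P
  meas : ∀ t : ℝ, Measurable (X t)
  init : ∀ᵐ ω ∂P, X 0 ω = 0
  indep : ∀ s t : ℝ, 0 ≤ s → 0 ≤ t →
    IndepFun (fun ω => X (t + s) ω - X t ω)
      (fun ω => (fun r : {r : ℝ // 0 ≤ r ∧ r ≤ t} => X r ω)) P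
  stat : ∀ s t : ℝ, 0 ≤ s → 0 ≤ t →
    Measure.map (fun ω => X (t + s) ω - X t ω) P = Measure.map (X s) P
  contProb : ∀ t : ℝ, 0 ≤ t → ∀ ε : ℝ, 0 < ε →
    Tendsto (fun s : ℝ => P {ω | ε ≤ |X s ω - X t ω|}) (𝓝[Set.Ici 0] t) (𝓝 0)

/-- A function that is right-continuous on `[0, ∞)` with left limits on `(0, ∞)`. -/
structure IsCadlag {E : Type*} [TopologicalSpace E] (f : ℝ → E) : Prop where
  right_cont : ∀ t : ℝ, 0 ≤ t → ContinuousWithinAt f (Set.Ici t) t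
  left_lim : ∀ t : ℝ, 0 < t → ∃ l, Tendsto f (𝓝[<] t) (𝓝 l)

/-- The positive times at which `f` has a jump belonging to `B`. -/
def jumpTimes {E : Type*} [NormedAddCommGroup E] (f : ℝ → E) (B : Set E) : Set ℝ :=
  {s | 0 < s ∧ ∃ l, Tendsto f (𝓝[<] s) (𝓝 l) ∧ f s - l ∈ B}

section Paths

variable {E : Type*} [NormedAddCommGroup E] {f : ℝ → E} {B U : Set E} {s t : ℝ}

lemma mem_jumpTimes_iff (hs : 0 < s) {l : E} (hl : Tendsto f (𝓝[<] s) (𝓝 l)) :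
    s ∈ jumpTimes f B ↔ f s - l ∈ B := by
  refine ⟨fun ⟨_, l', hl', h⟩ => ?_, fun h => ⟨hs, l, hl, h⟩⟩
  rwa [tendsto_nhds_unique hl hl']

lemma jumpTimes_iUnion {ι : Type*} (B : ι → Set E) :
    jumpTimes f (⋃ i, B i) = ⋃ i, jumpTimes f (B i) := by
  ext s
  simp only [jumpTimes, Set.mem_ofPred_eq, Set.mem_iUnion]
  exact ⟨fun ⟨h, l, hl, i, hi⟩ => ⟨i, h, l, hl, hi⟩, fun ⟨i, h, l, hl, hi⟩ => ⟨h, l, hl, i, hi⟩⟩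

lemma jumpTimes_mono {B C : Set E} (h : B ⊆ C) : jumpTimes f B ⊆ jumpTimes f C :=
  fun _ ⟨hs, l, hl, hB⟩ => ⟨hs, l, hl, h hB⟩

lemma disjoint_jumpTimes {B C : Set E} (h : Disjoint B C) :
    Disjoint (jumpTimes f B) (jumpTimes f C) := by
  rw [Set.disjoint_left] at h ⊢
  rintro s ⟨hs, l, hl, hB⟩ hC
  exact h hB ((mem_jumpTimes_iff hs hl).1 hC)

namespace IsCadlag

lemma tendsto_sub {F G : Filter ℝ} {x y : E} (hx : Tendsto f F (𝓝 x)) (hy : Tendsto f G (𝓝 y)) :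
    Tendsto (fun z : ℝ × ℝ => f z.2 - f z.1) (F ×ˢ G) (𝓝 (y - x)) :=
  (hy.comp tendsto_snd).sub (hx.comp tendsto_fst)

lemma tendsto_sub_right (hf : IsCadlag f) (hs : 0 ≤ s) :
    Tendsto (fun z : ℝ × ℝ => f z.2 - f z.1) (𝓝[≥] s ×ˢ 𝓝[≥] s) (𝓝 0) := by
  simpa using tendsto_sub (hf.right_cont s hs) (hf.right_cont s hs)

lemma eventually_right_notMem (hf : IsCadlag f) (hB : (0 : E) ∉ closure B) (hs : 0 ≤ s) :
    ∀ᶠ u in 𝓝[>] s, u ∉ jumpTimes f B := by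
  obtain ⟨ε, hε, hεB⟩ := Metric.nhds_basis_closedBall.mem_iff.1
    (isClosed_closure.isOpen_compl.mem_nhds hB)
  have h := (hf.tendsto_sub_right hs).eventually (Metric.closedBall_mem_nhds 0 hε)
  obtain ⟨W, hW, hWs⟩ := (Filter.eventually_prod_self_iff'.1 h)
  obtain ⟨b, hb, hbW⟩ := mem_nhdsGE_iff_exists_Ico_subset.1 hW
  filter_upwards [Ioo_mem_nhdsGT hb] with u hu
  rintro ⟨hu0, l, hl, hlB⟩
  refine hεB ?_ (subset_closure hlB)
  refine Metric.isClosed_closedBall.mem_of_tendsto (tendsto_const_nhds.sub hl) ?_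
  filter_upwards [Ioo_mem_nhdsLT hu.1] with p hp
  exact hWs p (hbW ⟨hp.1.le, hp.2.trans hu.2⟩) u (hbW ⟨hu.1.le, hu.2⟩)

lemma eventually_left_notMem (hf : IsCadlag f) (hB : (0 : E) ∉ closure B) (hs : 0 < s) :
    ∀ᶠ u in 𝓝[<] s, u ∉ jumpTimes f B := by
  obtain ⟨ε, hε, hεB⟩ := Metric.nhds_basis_closedBall.mem_iff.1
    (isClosed_closure.isOpen_compl.mem_nhds hB)
  obtain ⟨m, hm⟩ := hf.left_lim s hs
  have h := (tendsto_sub hm hm).eventually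
    (Metric.closedBall_mem_nhds _ hε)
  rw [sub_self] at h
  obtain ⟨W, hW, hWs⟩ := (Filter.eventually_prod_self_iff'.1 h)
  obtain ⟨b, hb, hbW⟩ := mem_nhdsLT_iff_exists_Ioo_subset.1 hW
  filter_upwards [Ioo_mem_nhdsLT hb] with u hu
  rintro ⟨hu0, l, hl, hlB⟩
  refine hεB ?_ (subset_closure hlB)
  refine Metric.isClosed_closedBall.mem_of_tendsto (tendsto_const_nhds.sub hl) ?_
  filter_upwards [Ioo_mem_nhdsLT hu.1] with p hp
  exact hWs p (hbW ⟨hp.1, hp.2.trans hu.2⟩) u (hbW hu)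

lemma finite_jumpTimes (hf : IsCadlag f) (hB : (0 : E) ∉ closure B) (t : ℝ) :
    (jumpTimes f B ∩ Set.Ioc 0 t).Finite := by
  have key : (jumpTimes f B ∩ Set.Icc 0 t).Finite := by
    rw [Set.inter_comm]
    refine isCompact_Icc.induction_on (p := fun S => (S ∩ jumpTimes f B).Finite) (by simp)
      (fun S T hST hT => hT.subset (Set.inter_subset_inter_left _ hST))
      (fun S T hS hT => by rw [Set.union_inter_distrib_right]; exact hS.union hT)
      (fun s hs => ?_)
    have hleft : ∀ᶠ u in 𝓝[<] s, u ∉ jumpTimes f B := by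
      rcases hs.1.eq_or_lt with h0 | h0
      · subst h0
        filter_upwards [self_mem_nhdsWithin] with u hu hu'
        exact lt_asymm hu hu'.1
      · exact hf.eventually_left_notMem hB h0
    have hne : ∀ᶠ u in 𝓝[≠] s, u ∉ jumpTimes f B := by
      rw [← Set.Iio_union_Ioi, nhdsWithin_union]
      exact Filter.eventually_sup.2 ⟨hleft, hf.eventually_right_notMem hB hs.1⟩
    rw [eventually_nhdsWithin_iff] at hne
    refine ⟨_, mem_nhdsWithin_of_mem_nhds hne, (Set.finite_singleton s).subset ?_⟩
    rintro u ⟨hu, huJ⟩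
    by_contra h
    exact hu h huJ
  exact key.subset (Set.inter_subset_inter_right _ Set.Ioc_subset_Icc_self)

lemma exists_forall_sub_notMem (hf : IsCadlag f) {K : Set E} (hK : IsClosed K)
    (hK0 : (0 : E) ∉ K) {a b : ℝ} (ha : 0 ≤ a) (h : ¬(jumpTimes f K ∩ Set.Ioc a b).Nonempty) :
    ∃ δ > 0, ∀ p q, a ≤ p → p < q → q ≤ b → q - p < δ → f q - f p ∉ K := by
  have hloc : ∀ s ∈ Set.Icc a b, ∃ W, IsOpen W ∧ s ∈ W ∧
      ∀ p ∈ W, ∀ q ∈ W, a ≤ p → p < q → f q - f p ∉ K := by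
    intro s hs
    have hs0 := ha.trans hs.1
    have h0 : Kᶜ ∈ 𝓝 (0 : E) := hK.isOpen_compl.mem_nhds hK0
    obtain ⟨R, hR, hRs⟩ := Filter.eventually_prod_self_iff'.1
      ((hf.tendsto_sub_right hs0).eventually h0)
    rw [mem_nhdsWithin_iff_exists_mem_nhds_inter] at hR
    obtain ⟨R', hR', hRR⟩ := hR
    rcases hs.1.eq_or_lt with has | has
    · obtain ⟨W, hWR, hWo, hsW⟩ := mem_nhds_iff.1 hR'
      refine ⟨W, hWo, hsW, fun p hp q hq hap hpq => ?_⟩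
      exact hRs p (hRR ⟨hWR hp, has ▸ hap⟩) q (hRR ⟨hWR hq, has ▸ (hap.trans hpq.le)⟩)
    · obtain ⟨l, hl⟩ := hf.left_lim s (ha.trans_lt has)
      have hlK : Kᶜ ∈ 𝓝 (f s - l) := hK.isOpen_compl.mem_nhds fun hmem =>
        h ⟨s, ⟨ha.trans_lt has, l, hl, hmem⟩, has, hs.2⟩
      have h0' := (tendsto_sub hl hl)
      rw [sub_self] at h0'
      obtain ⟨L, hL, hLs⟩ := Filter.eventually_prod_self_iff'.1 (h0'.eventually h0)
      obtain ⟨pL, hpL, pR, hpR, hLR⟩ := Filter.eventually_prod_iff.1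
        ((tendsto_sub hl (hf.right_cont s hs0)).eventually hlK)
      have hL2 : ∀ᶠ u in 𝓝[<] s, u ∈ L ∧ pL u := Filter.Eventually.and hL hpL
      rw [eventually_nhdsWithin_iff] at hL2 hpR
      obtain ⟨W, hWR, hWo, hsW⟩ := mem_nhds_iff.1 (inter_mem hR' (inter_mem hL2 hpR))
      refine ⟨W, hWo, hsW, fun p hp q hq hap hpq => ?_⟩
      rcases lt_or_ge p s with hps | hps
      · rcases lt_or_ge q s with hqs | hqs
        · exact hLs p ((hWR hp).2.1 hps).1 q ((hWR hq).2.1 hqs).1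
        · exact hLR ((hWR hp).2.1 hps).2 ((hWR hq).2.2 hqs)
      · exact hRs p (hRR ⟨(hWR hp).1, hps⟩) q (hRR ⟨(hWR hq).1, hps.trans hpq.le⟩)
  choose! W hWo hsW hW using hloc
  obtain ⟨δ, hδ, hδW⟩ := lebesgue_number_lemma_of_metric (isCompact_Icc (a := a) (b := b))
    (c := fun s : Set.Icc a b => W s) (fun s => hWo s s.2)
    (fun s hs => Set.mem_iUnion.2 ⟨⟨s, hs⟩, hsW s hs⟩)
  refine ⟨δ, hδ, fun p q hap hpq hqb hlt => ?_⟩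
  obtain ⟨s, hs⟩ := hδW p ⟨hap, hpq.le.trans hqb⟩
  refine hW s s.2 p (hs (Metric.mem_ball_self hδ)) q (hs ?_) hap hpq
  rw [Metric.mem_ball, Real.dist_eq, abs_of_pos (sub_pos.2 hpq)]
  exact hlt

lemma nonempty_jumpTimes_iff (hf : IsCadlag f) (hU : IsOpen U) (hU0 : (0 : E) ∉ U) {a b : ℝ}
    (ha : 0 ≤ a) :
    (jumpTimes f U ∩ Set.Ioc a b).Nonempty ↔ ∃ j : ℕ, ∀ n : ℕ,
      ∃ p ∈ insert b (Set.range ((↑) : ℚ → ℝ)), ∃ q ∈ insert b (Set.range ((↑) : ℚ → ℝ)),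
        (a ≤ p ∧ p < q ∧ q ≤ b ∧ q - p < 1 / ((n : ℝ) + 1)) ∧
          1 / ((j : ℝ) + 1) ≤ Metric.infDist (f q - f p) Uᶜ := by
  constructor
  · rintro ⟨s, ⟨hs0, l, hl, hlU⟩, has, hsb⟩
    have hpos : 0 < Metric.infDist (f s - l) Uᶜ := by
      rw [← hU.isClosed_compl.notMem_iff_infDist_pos ⟨0, hU0⟩]
      simpa using hlU
    obtain ⟨j, hj⟩ := exists_nat_one_div_lt hpos
    refine ⟨j, fun n => ?_⟩
    set D := insert b (Set.range ((↑) : ℚ → ℝ))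
    have hev := ((Metric.continuous_infDist_pt Uᶜ).tendsto _).comp
      (tendsto_sub hl (hf.right_cont s hs0.le)) |>.eventually (lt_mem_nhds hj)
    have hn : (0 : ℝ) < 1 / ((n : ℝ) + 1) := by positivity
    obtain ⟨pL, hpL, pR, hpR, hLR⟩ := Filter.eventually_prod_iff.1 hev
    obtain ⟨c, hc, hcL⟩ := mem_nhdsLT_iff_exists_Ioo_subset.1
      (Filter.inter_mem hpL (Ioo_mem_nhdsLT (max_lt has (sub_lt_self s (half_pos hn)))))
    obtain ⟨p, hp⟩ := exists_rat_btwn (Set.mem_Iio.1 hc)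
    have hp' := hcL hp
    have hpa := max_lt_iff.1 hp'.2.1
    obtain ⟨q, hqD, hsq, hqb, hqn, hqR⟩ : ∃ q ∈ D, s ≤ q ∧ q ≤ b ∧
        q < s + 1 / ((n : ℝ) + 1) / 2 ∧ pR q := by
      rcases hsb.eq_or_lt with rfl | hsb
      · refine ⟨s, Set.mem_insert _ _, le_rfl, le_rfl, by linarith [half_pos hn], ?_⟩
        exact mem_of_mem_nhdsWithin Set.self_mem_Ici hpR
      · obtain ⟨d, hd, hdR⟩ := mem_nhdsGE_iff_exists_Ico_subset.1 hpR
        obtain ⟨q, hq⟩ := exists_rat_btwn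
          (lt_min hsb (lt_min hd (lt_add_of_pos_right s (half_pos hn))))
        have hq2 := lt_min_iff.1 hq.2
        have hq3 := lt_min_iff.1 hq2.2
        exact ⟨q, Set.mem_insert_of_mem _ ⟨q, rfl⟩, hq.1.le, hq2.1.le, hq3.2, hdR ⟨hq.1.le, hq3.1⟩⟩
    refine ⟨p, Set.mem_insert_of_mem _ ⟨p, rfl⟩, q, hqD,
      ⟨hpa.1.le, hp.2.trans_le hsq, hqb, by linarith [hpa.2]⟩, ?_⟩
    exact (hLR hp'.1 hqR).le
  · rintro ⟨j, hj⟩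
    by_contra hne
    have hj0 : (0 : ℝ) < 1 / ((j : ℝ) + 1) := by positivity
    let K : Set E := {x | 1 / ((j : ℝ) + 1) ≤ Metric.infDist x Uᶜ}
    have hKU : K ⊆ U := by
      intro x hx
      by_contra hxU
      have : Metric.infDist x Uᶜ = 0 := Metric.infDist_zero_of_mem hxU
      exact absurd hx (by simp only [K, Set.mem_ofPred_eq, this, not_le]; exact hj0)
    have hK : IsClosed K := isClosed_le continuous_const (Metric.continuous_infDist_pt _)
    obtain ⟨δ, hδ, hδK⟩ := hf.exists_forall_sub_notMem hK (fun h => hU0 (hKU h)) ha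
      (b := b) fun h => hne (h.mono (Set.inter_subset_inter_left _ (jumpTimes_mono hKU)))
    obtain ⟨n, hn⟩ := exists_nat_one_div_lt hδ
    obtain ⟨p, -, q, -, ⟨h1, h2, h3, h4⟩, h5⟩ := hj n
    exact hδK p q h1 h2 h3 (h4.trans hn) h5

end IsCadlag

end Paths

section Counting

variable {J : Set ℝ}

lemma ncard_inter_Ioc_add (hJ : ∀ t, (J ∩ Set.Ioc 0 t).Finite) {a b c : ℝ} (ha : 0 ≤ a)
    (hab : a ≤ b) (hbc : b ≤ c) :
    (J ∩ Set.Ioc a b).ncard + (J ∩ Set.Ioc b c).ncard = (J ∩ Set.Ioc a c).ncard := by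
  have hfin : (J ∩ Set.Ioc a c).Finite :=
    (hJ c).subset (Set.inter_subset_inter_right _ (Set.Ioc_subset_Ioc_left ha))
  rw [← Set.Ioc_union_Ioc_eq_Ioc hab hbc, Set.inter_union_distrib_left] at hfin ⊢
  refine (Set.ncard_union_eq ?_ (hfin.subset Set.subset_union_left)
    (hfin.subset Set.subset_union_right)).symm
  exact (Set.Ioc_disjoint_Ioc_of_le le_rfl).mono Set.inter_subset_right Set.inter_subset_right

lemma eventually_sum_min_one_ncard (hJ : ∀ t, (J ∩ Set.Ioc 0 t).Finite) {a T : ℝ} (ha : 0 ≤ a)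
    (hT : 0 ≤ T) : ∀ᶠ m : ℕ in atTop,
      ∑ i ∈ Finset.range m,
        min 1 (J ∩ Set.Ioc (a + i * (T / m)) (a + (i + 1 : ℕ) * (T / m))).ncard =
        (J ∩ Set.Ioc a (a + T)).ncard := by
  have hfin : (J ∩ Set.Ioc a (a + T)).Finite :=
    (hJ _).subset (Set.inter_subset_inter_right _ (Set.Ioc_subset_Ioc_left ha))
  have hsep : ∀ᶠ m : ℕ in atTop, ∀ x ∈ J ∩ Set.Ioc a (a + T), ∀ y ∈ J ∩ Set.Ioc a (a + T),
      x ≠ y → T / m < |x - y| := by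
    refine (Filter.eventually_all_finite hfin).2 fun x _ =>
      (Filter.eventually_all_finite hfin).2 fun y _ => ?_
    by_cases hxy : x = y
    · simp [hxy]
    · filter_upwards [(tendsto_const_div_atTop_nhds_zero_nat T).eventually_lt_const
        (abs_pos.2 (sub_ne_zero.2 hxy))] with m hm _ using hm
  filter_upwards [hsep, eventually_gt_atTop 0] with m hm hm0
  have hm0' : (0 : ℝ) < m := by exact_mod_cast hm0
  have hh : 0 ≤ T / m := by positivity
  have key : ∀ k ≤ m, ∑ i ∈ Finset.range k,
      min 1 (J ∩ Set.Ioc (a + i * (T / m)) (a + (i + 1 : ℕ) * (T / m))).ncard =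
      (J ∩ Set.Ioc a (a + k * (T / m))).ncard := by
    intro k
    induction k with
    | zero => simp
    | succ k ih =>
      intro hk
      have hk' : ((k + 1 : ℕ) : ℝ) ≤ m := by exact_mod_cast hk
      have hkT : ((k + 1 : ℕ) : ℝ) * (T / m) ≤ T := by
        calc ((k + 1 : ℕ) : ℝ) * (T / m) ≤ m * (T / m) := by gcongr
          _ = T := by field_simp
      have hk0 : 0 ≤ k * (T / m) := by positivity
      have hkk : (k : ℝ) * (T / m) ≤ (k + 1 : ℕ) * (T / m) := by
        gcongr
        simp
      rw [Finset.sum_range_succ, ih (by omega),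
        ← ncard_inter_Ioc_add hJ (b := a + k * (T / m)) (c := a + (k + 1 : ℕ) * (T / m)) ha
          (le_add_of_nonneg_right hk0) (by linarith)]
      congr 1
      rw [min_eq_right]
      have hsub : J ∩ Set.Ioc (a + k * (T / m)) (a + (k + 1 : ℕ) * (T / m)) ⊆
          J ∩ Set.Ioc a (a + T) :=
        Set.inter_subset_inter_right _ (Set.Ioc_subset_Ioc (by linarith) (by linarith))
      refine (Set.ncard_le_one (hfin.subset hsub)).2 fun x hx y hy => ?_
      by_contra hxy
      have h := hm x (hsub hx) y (hsub hy) hxy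
      have h1 := hx.2
      have h2 := hy.2
      rw [Set.mem_Ioc] at h1 h2
      push_cast at h1 h2
      refine absurd h (not_lt.2 (abs_le.2 ⟨?_, ?_⟩)) <;> linarith
  rw [key m le_rfl]
  congr 4
  field_simp

end Counting

/-- The space of càdlàg paths `[0, ∞) → E`, with the σ-algebra generated by the evaluations. -/
abbrev CadlagPath (E : Type*) [TopologicalSpace E] : Type _ :=
  {y : NNReal → E // IsCadlag fun u : ℝ => y u.toNNReal}

namespace CadlagPath

/-- A càdlàg path, extended to negative times by its value at `0`. -/
def path {E : Type*} [TopologicalSpace E] (y : CadlagPath E) : ℝ → E := fun u => y.1 u.toNNReal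

lemma isCadlag_path {E : Type*} [TopologicalSpace E] (y : CadlagPath E) : IsCadlag y.path := y.2

variable {E : Type*} [NormedAddCommGroup E] [MeasurableSpace E]

lemma measurable_path (u : ℝ) : Measurable fun y : CadlagPath E => y.path u :=
  (measurable_pi_apply _).comp measurable_subtype_coe

variable [BorelSpace E] [SecondCountableTopology E]

lemma measurableSet_nonempty_jumpTimes {U : Set E} (hU : IsOpen U) (hU0 : (0 : E) ∉ U) {a : ℝ}
    (ha : 0 ≤ a) (b : ℝ) :
    MeasurableSet {y : CadlagPath E | (jumpTimes y.path U ∩ Set.Ioc a b).Nonempty} := by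
  simp_rw [fun y : CadlagPath E => y.isCadlag_path.nonempty_jumpTimes_iff hU hU0 ha (b := b)]
  have hD : (insert b (Set.range ((↑) : ℚ → ℝ))).Countable := (Set.countable_range _).insert b
  have : {y : CadlagPath E | ∃ j : ℕ, ∀ n : ℕ,
      ∃ p ∈ insert b (Set.range ((↑) : ℚ → ℝ)), ∃ q ∈ insert b (Set.range ((↑) : ℚ → ℝ)),
        (a ≤ p ∧ p < q ∧ q ≤ b ∧ q - p < 1 / ((n : ℝ) + 1)) ∧
          1 / ((j : ℝ) + 1) ≤ Metric.infDist (y.path q - y.path p) Uᶜ} =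
      ⋃ j : ℕ, ⋂ n : ℕ, ⋃ p ∈ insert b (Set.range ((↑) : ℚ → ℝ)),
        ⋃ q ∈ insert b (Set.range ((↑) : ℚ → ℝ)),
        {y | (a ≤ p ∧ p < q ∧ q ≤ b ∧ q - p < 1 / ((n : ℝ) + 1)) ∧
          1 / ((j : ℝ) + 1) ≤ Metric.infDist (y.path q - y.path p) Uᶜ} := by
    ext y
    simp only [Set.mem_ofPred_eq, Set.mem_iUnion, Set.mem_iInter, exists_prop]
  rw [this]
  refine MeasurableSet.iUnion fun j => MeasurableSet.iInter fun n =>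
    MeasurableSet.biUnion hD fun p _ => MeasurableSet.biUnion hD fun q _ =>
    (MeasurableSet.const _).inter ?_
  exact measurableSet_le measurable_const
    ((Metric.continuous_infDist_pt _).measurable.comp ((measurable_path q).sub (measurable_path p)))

lemma measurable_ncard_of_isOpen {U : Set E} (hU : IsOpen U) (hU0 : (0 : E) ∉ closure U) {t : ℝ}
    (ht : 0 ≤ t) :
    Measurable fun y : CadlagPath E => (jumpTimes y.path U ∩ Set.Ioc 0 t).ncard := by
  have hfin (y : CadlagPath E) := y.isCadlag_path.finite_jumpTimes hU0
  have hU0' : (0 : E) ∉ U := fun h => hU0 (subset_closure h)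
  refine measurable_of_tendsto_metrizable (f := fun (m : ℕ) (y : CadlagPath E) =>
    ∑ i ∈ Finset.range m, min 1 (jumpTimes y.path U ∩
      Set.Ioc (0 + i * (t / m)) (0 + (i + 1 : ℕ) * (t / m))).ncard) (fun m => ?_) ?_
  · refine Finset.measurable_fun_sum _ fun i _ => ?_
    have ha : 0 ≤ 0 + i * (t / m) := by positivity
    generalize 0 + i * (t / m) = a at *
    generalize 0 + (i + 1 : ℕ) * (t / m) = b at *
    have hs := measurableSet_nonempty_jumpTimes hU hU0' ha b
    classical
    suffices h : (fun y : CadlagPath E => min 1 (jumpTimes y.path U ∩ Set.Ioc a b).ncard) =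
        fun y => if (jumpTimes y.path U ∩ Set.Ioc a b).Nonempty then 1 else 0 by
      rw [h]
      exact Measurable.ite hs measurable_const measurable_const
    ext y
    have hfin' : (jumpTimes y.path U ∩ Set.Ioc a b).Finite :=
      (hfin y b).subset (Set.inter_subset_inter_right _ (Set.Ioc_subset_Ioc_left ha))
    split_ifs with h
    · exact min_eq_left ((Set.ncard_pos hfin').2 h)
    · rw [Set.not_nonempty_iff_eq_empty.1 h]
      simp
  · refine tendsto_pi_nhds.2 fun y => tendsto_nhds_of_eventually_eq ?_
    simpa using eventually_sum_min_one_ncard (hfin y) le_rfl ht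

lemma measurable_ncard {B : Set E} (hB : MeasurableSet B) (hB0 : (0 : E) ∉ closure B) (t : ℝ) :
    Measurable fun y : CadlagPath E => (jumpTimes y.path B ∩ Set.Ioc 0 t).ncard := by
  rcases lt_or_ge t 0 with ht | ht
  · simp [Set.Ioc_eq_empty (not_lt.2 ht.le)]
  obtain ⟨ε, hε, hεB⟩ := Metric.nhds_basis_closedBall.mem_iff.1
    (isClosed_closure.isOpen_compl.mem_nhds hB0)
  let V : Set E := (Metric.closedBall 0 ε)ᶜ
  have hVo : IsOpen V := Metric.isClosed_closedBall.isOpen_compl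
  have hV0 {C : Set E} : (0 : E) ∉ closure (C ∩ V) := by
    have hsub : closure (C ∩ V) ⊆ (Metric.ball 0 ε)ᶜ :=
      closure_minimal (Set.inter_subset_right.trans
        (Set.compl_subset_compl.2 Metric.ball_subset_closedBall)) Metric.isOpen_ball.isClosed_compl
    exact fun h => hsub h (Metric.mem_ball_self hε)
  have hfin (y : CadlagPath E) (C : Set E) : (jumpTimes y.path (C ∩ V) ∩ Set.Ioc 0 t).Finite :=
    y.isCadlag_path.finite_jumpTimes hV0 t
  have hmeas (y : CadlagPath E) (C : Set E) :
      MeasurableSet (jumpTimes y.path (C ∩ V) ∩ Set.Ioc 0 t) := (hfin y C).measurableSet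
  have hcard (y : CadlagPath E) (C : Set E) :
      Measure.count (jumpTimes y.path (C ∩ V) ∩ Set.Ioc 0 t) =
        ((jumpTimes y.path (C ∩ V) ∩ Set.Ioc 0 t).ncard : ENNReal) := by
    rw [Measure.count_apply_finite _ (hfin y C), Set.ncard_eq_toFinset_card _ (hfin y C)]
  have hcount {C : Set E} (hC : MeasurableSet C) : Measurable fun y : CadlagPath E =>
      Measure.count (jumpTimes y.path (C ∩ V) ∩ Set.Ioc 0 t) := by
    have hopen {C : Set E} (hC : IsOpen C) : Measurable fun y : CadlagPath E =>
        Measure.count (jumpTimes y.path (C ∩ V) ∩ Set.Ioc 0 t) := by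
      simp_rw [hcard]
      exact (measurable_from_top (f := ((↑) : ℕ → ENNReal))).comp
        (measurable_ncard_of_isOpen (hC.inter hVo) hV0 ht)
    have hborel : ‹MeasurableSpace E› = MeasurableSpace.generateFrom {s | IsOpen s} := by
      rw [BorelSpace.measurable_eq (α := E), borel]
    induction C, hC using MeasurableSpace.induction_on_inter hborel isPiSystem_isOpen with
    | empty => exact hopen isOpen_empty
    | basic C hC => exact hopen hC
    | compl C hC ih =>
      convert (hopen isOpen_univ).sub ih using 2 with y
      rw [Pi.sub_apply, ← measure_sdiff _ (hmeas y C).nullMeasurableSet]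
      · congr 1
        ext s
        constructor
        · rintro ⟨⟨hs, l, hl, h⟩, hst⟩
          exact ⟨⟨⟨hs, l, hl, trivial, h.2⟩, hst⟩, fun h' =>
            h.1 ((mem_jumpTimes_iff hs hl).1 h'.1).1⟩
        · rintro ⟨⟨⟨hs, l, hl, h⟩, hst⟩, h'⟩
          exact ⟨⟨hs, l, hl, fun hC => h' ⟨⟨hs, l, hl, hC, h.2⟩, hst⟩, h.2⟩, hst⟩
      · rw [hcard]
        exact ENNReal.natCast_ne_top _
      · exact Set.inter_subset_inter_left _
          (jumpTimes_mono (Set.inter_subset_inter_left _ (Set.subset_univ _)))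
    | iUnion C hd hC ih =>
      convert Measurable.tsum (L := SummationFilter.unconditional ℕ) ih using 2 with y
      rw [Set.iUnion_inter, jumpTimes_iUnion, Set.iUnion_inter, measure_iUnion _ fun i => hmeas y _]
      intro i j hij
      exact (disjoint_jumpTimes ((hd hij).mono Set.inter_subset_left Set.inter_subset_left)).mono
        Set.inter_subset_left Set.inter_subset_left
  have hBV : B ∩ V = B := Set.inter_eq_left.2 fun x hx hxε => hεB hxε (subset_closure hx)
  have h := (hcount hB).ennreal_toReal
  simp_rw [hcard, hBV, ENNReal.toReal_natCast] at h
  simpa [Function.comp_def] using Nat.measurable_floor.comp h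

end CadlagPath

section PathTransformations

variable {E : Type*} [NormedAddCommGroup E] {f g : ℝ → E} {B : Set E} {s t : ℝ}

lemma mem_jumpTimes_congr (h : ∀ u, 0 < u → u ≤ s → f u = g u) :
    s ∈ jumpTimes f B ↔ s ∈ jumpTimes g B := by
  refine and_congr_right fun hs => exists_congr fun l => ?_
  rw [h s hs le_rfl, tendsto_congr' (f₂ := g)]
  filter_upwards [Ioo_mem_nhdsLT hs] with u hu using h u hu.1 hu.2.le

namespace IsCadlag

lemma comp_toNNReal (hf : IsCadlag f) : IsCadlag fun u : ℝ => f u.toNNReal where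
  right_cont t ht := (hf.right_cont t ht).congr
    (fun u hu => by rw [Real.coe_toNNReal _ (ht.trans hu)]) (by rw [Real.coe_toNNReal _ ht])
  left_lim t ht := by
    obtain ⟨l, hl⟩ := hf.left_lim t ht
    refine ⟨l, hl.congr' ?_⟩
    filter_upwards [Ioo_mem_nhdsLT ht] with u hu
    rw [Real.coe_toNNReal _ hu.1.le]

/-- The restriction of a càdlàg function to `[0, ∞)`. -/
def toPath (hf : IsCadlag f) : CadlagPath E := ⟨fun u => f u, hf.comp_toNNReal⟩

lemma jumpTimes_toPath (hf : IsCadlag f) : jumpTimes hf.toPath.path B = jumpTimes f B := by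
  ext s
  refine mem_jumpTimes_congr fun u hu _ => ?_
  simp [toPath, CadlagPath.path, hu.le]

lemma tendsto_const_add_nhdsLT (t s : ℝ) : Tendsto (fun u => t + u) (𝓝[<] s) (𝓝[<] (t + s)) :=
  tendsto_nhdsWithin_of_tendsto_nhds_of_eventually_within _
    ((continuous_const.add continuous_id).tendsto s |>.mono_left nhdsWithin_le_nhds)
    (by filter_upwards [self_mem_nhdsWithin] with u hu using (add_lt_add_iff_left t).2 hu)

lemma shift (hf : IsCadlag f) (ht : 0 ≤ t) : IsCadlag fun u => f (t + u) - f t where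
  right_cont s hs := by
    refine ContinuousWithinAt.sub ?_ continuousWithinAt_const
    exact (hf.right_cont (t + s) (add_nonneg ht hs)).comp
      (continuous_const.add continuous_id).continuousWithinAt
      fun u hu => (add_le_add_iff_left t).2 hu
  left_lim s hs := by
    obtain ⟨l, hl⟩ := hf.left_lim (t + s) (add_pos_of_nonneg_of_pos ht hs)
    exact ⟨l - f t, (hl.comp (tendsto_const_add_nhdsLT t s)).sub_const _⟩

lemma comp_min (hf : IsCadlag f) (ht : 0 ≤ t) : IsCadlag fun u => f (min u t) where
  right_cont s hs := (hf.right_cont (min s t) (le_min hs ht)).comp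
    (f := fun u => min u t) (t := Set.Ici (min s t))
    (continuous_id.min continuous_const).continuousWithinAt
    fun u hu => min_le_min_right t hu
  left_lim s hs := by
    rcases le_or_gt s t with hst | hst
    · obtain ⟨l, hl⟩ := hf.left_lim s hs
      refine ⟨l, hl.congr' ?_⟩
      filter_upwards [self_mem_nhdsWithin] with u hu
      rw [min_eq_left (le_of_lt (lt_of_lt_of_le hu hst))]
    · refine ⟨f t, tendsto_const_nhds.congr' ?_⟩
      filter_upwards [Ioo_mem_nhdsLT hst] with u hu
      rw [min_eq_right hu.1.le]

lemma ncard_jumpTimes_shift (hf : IsCadlag f) (ht : 0 ≤ t) (s : ℝ) :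
    (jumpTimes (fun u => f (t + u) - f t) B ∩ Set.Ioc 0 s).ncard =
      (jumpTimes f B ∩ Set.Ioc t (t + s)).ncard := by
  have hmem {u : ℝ} (hu : 0 < u) :
      u ∈ jumpTimes (fun u => f (t + u) - f t) B ↔ t + u ∈ jumpTimes f B := by
    have htu := add_pos_of_nonneg_of_pos ht hu
    obtain ⟨l, hl⟩ := hf.left_lim (t + u) htu
    have hl' : Tendsto (fun u => f (t + u) - f t) (𝓝[<] u) (𝓝 (l - f t)) :=
      (hl.comp (tendsto_const_add_nhdsLT t u)).sub_const (f t)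
    rw [mem_jumpTimes_iff htu hl, mem_jumpTimes_iff hu hl', sub_sub_sub_cancel_right]
  rw [← Set.ncard_image_of_injective _ (add_right_injective t)]
  congr 1
  ext v
  constructor
  · rintro ⟨u, ⟨hu, hu0, hus⟩, rfl⟩
    exact ⟨(hmem hu0).1 hu, lt_add_of_pos_right t hu0, (add_le_add_iff_left t).2 hus⟩
  · rintro ⟨hv, hv0, hvs⟩
    have h0 : 0 < v - t := sub_pos.2 hv0
    exact ⟨v - t, ⟨(hmem h0).2 (by simpa using hv), h0, by linarith⟩, by simp⟩

end IsCadlag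

end PathTransformations

section SubtypeLaws

variable {Ω α β : Type*} [MeasurableSpace Ω] [MeasurableSpace α] [MeasurableSpace β]
  {P : Measure Ω} {p : α → Prop} {f g : Ω → Subtype p} {h : Ω → β}

lemma map_subtype_ext (hf : Measurable f) (hg : Measurable g)
    (hfg : P.map (fun ω => (f ω : α)) = P.map fun ω => (g ω : α)) : P.map f = P.map g := by
  ext s hs
  obtain ⟨s, hs, rfl⟩ := hs
  rw [Measure.map_apply hf (measurable_subtype_coe hs),
    Measure.map_apply hg (measurable_subtype_coe hs)]
  have ef := Measure.map_apply (μ := P) (measurable_subtype_coe.comp hf) hs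
  have eg := Measure.map_apply (μ := P) (measurable_subtype_coe.comp hg) hs
  exact ef.symm.trans ((congrArg (· s) hfg).trans eg)

lemma indepFun_subtype (hfh : IndepFun (fun ω => (f ω : α)) h P) : IndepFun f h P := by
  rw [indepFun_iff_measure_inter_preimage_eq_mul] at hfh ⊢
  rintro s u ⟨s, hs, rfl⟩ hu
  exact hfh s u hs hu

end SubtypeLaws

namespace IsLevyProcess

variable {Ω : Type*} [MeasurableSpace Ω] {P : Measure Ω} {n : ℕ}
  {X : ℝ → Ω → EuclideanSpace ℝ (Fin n)}

/-- The finite-dimensional distributions of `(X (t + u) - X t)_u` are those of `X`, and they are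
independent of the past of `X` up to time `t`. -/
lemma map_restrict_shift_past (hX : IsLevyProcess P X) {t : ℝ} (ht : 0 ≤ t) (I : Finset NNReal) :
    P.map (fun ω => (I.restrict fun u : NNReal => X (t + u) ω - X t ω,
      fun r : {r : ℝ // 0 ≤ r ∧ r ≤ t} => X r ω)) =
    (P.map fun ω => I.restrict fun u : NNReal => X u ω).prod
      (P.map fun ω => fun r : {r : ℝ // 0 ≤ r ∧ r ≤ t} => X r ω) := by
  have := hX.isProb
  have hmX := hX.meas
  have hQ : Measurable fun ω => fun r : {r : ℝ // 0 ≤ r ∧ r ≤ t} => X r ω :=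
    measurable_pi_lambda _ fun r => hX.meas _
  have hV (J : Finset NNReal) :
      Measurable fun ω => J.restrict fun u : NNReal => X (t + u) ω - X t ω :=
    measurable_pi_lambda _ fun u => (hX.meas _).sub (hX.meas _)
  have hV0 (J : Finset NNReal) : Measurable fun ω => J.restrict fun u : NNReal => X u ω :=
    measurable_pi_lambda _ fun u => hX.meas _
  induction I using Finset.induction_on_max with
  | empty =>
    have e : (fun ω => (∅ : Finset NNReal).restrict fun u : NNReal => X (t + u) ω - X t ω) =
        fun ω => (∅ : Finset NNReal).restrict fun u : NNReal => X u ω :=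
      funext fun ω => Subsingleton.elim _ _
    have e0 : (fun ω => (∅ : Finset NNReal).restrict fun u : NNReal => X u ω) =
        fun _ => (∅ : Finset NNReal).restrict fun _ : NNReal => (0 : EuclideanSpace ℝ (Fin n)) :=
      funext fun ω => Subsingleton.elim _ _
    rw [← indepFun_iff_map_prod_eq_prod_map_map (hV0 ∅).aemeasurable hQ.aemeasurable |>.1]
    · exact congrArg (P.map) (funext fun ω => Prod.ext (congrFun e ω) rfl)
    · rw [e0]
      exact indepFun_const_left _ _
  | insert a s hs ih =>
    set b : NNReal := s.sup id with hb
    have hba : b ≤ a := Finset.sup_le fun x hx => (hs x hx).le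
    have hbs {u : NNReal} (hu : u ∈ s) : u ≤ b := Finset.le_sup (f := id) hu
    have hb0 (h : b ∉ s) : b = 0 := by
      rcases s.eq_empty_or_nonempty with rfl | hne
      · simp [hb]
      · obtain ⟨i, hi, hib⟩ := Finset.exists_mem_eq_sup s hne id
        exact absurd (by rw [hb, hib]; exact hi) h
    have has : a ∉ s := fun h => lt_irrefl _ (hs a h)
    let E := EuclideanSpace ℝ (Fin n)
    let Ψ : E × (s → E) → (↥(insert a s) → E) := fun z u =>
      if h : u.1 ∈ s then z.2 ⟨u, h⟩ else z.1 + if hb : b ∈ s then z.2 ⟨b, hb⟩ else 0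
    have hΨ : Measurable Ψ := by
      refine measurable_pi_lambda _ fun u => ?_
      by_cases h : u.1 ∈ s
      · simp only [Ψ, h, dif_pos]
        fun_prop
      · by_cases hb : b ∈ s
        · simp only [Ψ, h, hb, dif_pos, dif_neg, not_false_eq_true]
          fun_prop
        · simp only [Ψ, h, hb, dif_neg, not_false_eq_true]
          fun_prop
    have hlaw (r : ℝ) (hr : 0 ≤ r) :
        P.map (fun ω => X (r + a) ω - X (r + b) ω) = P.map (X (a - b)) := by
      have := hX.stat (a - b) (r + b) (by simpa using hba) (by positivity)
      rwa [show r + b + ((a : ℝ) - b) = r + a by ring] at this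
    have hind (r : ℝ) (hr : 0 ≤ r) :=
      hX.indep (a - b) (r + b) (by simpa using hba) (by positivity)
    have hindt : IndepFun (fun ω => X (t + a) ω - X (t + b) ω)
        (fun ω => (s.restrict fun u : NNReal => X (t + u) ω - X t ω,
          fun r : {r : ℝ // 0 ≤ r ∧ r ≤ t} => X r ω)) P := by
      have h := hind t ht
      rw [show t + b + ((a : ℝ) - b) = t + a by ring] at h
      refine h.comp (ψ := fun w : {r : ℝ // 0 ≤ r ∧ r ≤ t + b} → E =>
        ((fun u : s => w ⟨t + u.1, by positivity, by simpa using hbs u.2⟩ -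
          w ⟨t, ht, by simp⟩),
        fun r : {r : ℝ // 0 ≤ r ∧ r ≤ t} =>
          w ⟨r, r.2.1, r.2.2.trans (by simp)⟩)) measurable_id ?_
      fun_prop
    have hind0 : IndepFun (fun ω => X a ω - X b ω)
        (fun ω => s.restrict fun u : NNReal => X u ω) P := by
      have h := hind 0 le_rfl
      rw [show 0 + b + ((a : ℝ) - b) = a by ring, zero_add] at h
      refine h.comp (ψ := fun w : {r : ℝ // 0 ≤ r ∧ r ≤ (b : ℝ)} → E =>
        (fun u : s => w ⟨u.1, by positivity, by simpa using hbs u.2⟩)) measurable_id ?_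
      fun_prop
    have hjoint : P.map (fun ω => (X (t + a) ω - X (t + b) ω,
        (s.restrict fun u : NNReal => X (t + u) ω - X t ω,
          fun r : {r : ℝ // 0 ≤ r ∧ r ≤ t} => X r ω))) =
        (P.map (X (a - b))).prod ((P.map fun ω => s.restrict fun u : NNReal => X u ω).prod
          (P.map fun ω => fun r : {r : ℝ // 0 ≤ r ∧ r ≤ t} => X r ω)) := by
      rw [(indepFun_iff_map_prod_eq_prod_map_map (by fun_prop)
        ((hV s).prodMk hQ).aemeasurable).1 hindt, hlaw t ht, ih]
    have hjoint0 : P.map (fun ω => (X a ω - X b ω, s.restrict fun u : NNReal => X u ω)) =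
        (P.map (X (a - b))).prod (P.map fun ω => s.restrict fun u : NNReal => X u ω) := by
      rw [(indepFun_iff_map_prod_eq_prod_map_map (by fun_prop) (hV0 s).aemeasurable).1 hind0]
      have := hlaw 0 le_rfl
      simp only [zero_add] at this
      rw [this]
    have hres : (fun ω => (insert a s).restrict fun u : NNReal => X (t + u) ω - X t ω) =
        fun ω => Ψ (X (t + a) ω - X (t + b) ω,
          s.restrict fun u : NNReal => X (t + u) ω - X t ω) := by
      funext ω u
      by_cases h : u.1 ∈ s
      · simp [Ψ, h]
      · have hua : u.1 = a := (Finset.mem_insert.1 u.2).resolve_right h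
        by_cases hbm : b ∈ s
        · simp [Ψ, hua, has, hbm]
        · simp [Ψ, hua, has, hb0 hbm]
    have hres0 : (fun ω => (insert a s).restrict fun u : NNReal => X u ω) =ᵐ[P]
        fun ω => Ψ (X a ω - X b ω, s.restrict fun u : NNReal => X u ω) := by
      filter_upwards [hX.init] with ω hω
      funext u
      by_cases h : u.1 ∈ s
      · simp [Ψ, h]
      · have hua : u.1 = a := (Finset.mem_insert.1 u.2).resolve_right h
        by_cases hbm : b ∈ s
        · simp [Ψ, hua, has, hbm]
        · simp [Ψ, hua, has, hb0 hbm, hω]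
    have hP1 : IsProbabilityMeasure (P.map (X (a - b))) :=
      Measure.isProbabilityMeasure_map (hmX _).aemeasurable
    have hP2 : IsProbabilityMeasure (P.map fun ω => s.restrict fun u : NNReal => X u ω) :=
      Measure.isProbabilityMeasure_map (hV0 s).aemeasurable
    have hP3 : IsProbabilityMeasure
        (P.map fun ω => fun r : {r : ℝ // 0 ≤ r ∧ r ≤ t} => X r ω) :=
      Measure.isProbabilityMeasure_map hQ.aemeasurable
    have hstep0 : P.map (fun ω => (insert a s).restrict fun u : NNReal => X u ω) =
        ((P.map (X (a - b))).prod
          (P.map fun ω => s.restrict fun u : NNReal => X u ω)).map Ψ := by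
      rw [Measure.map_congr hres0, ← hjoint0, Measure.map_map hΨ (by fun_prop)]
      rfl
    rw [hstep0]
    have hprod := Measure.map_prod_map ((P.map (X (a - b))).prod
      (P.map fun ω => s.restrict fun u : NNReal => X u ω))
      (P.map fun ω => fun r : {r : ℝ // 0 ≤ r ∧ r ≤ t} => X r ω) hΨ measurable_id
    rw [Measure.map_id] at hprod
    rw [hprod, ← (measurePreserving_prodAssoc _ _ _).symm.map_eq,
      ← hjoint, Measure.map_map (MeasurableEquiv.measurable _) (by fun_prop),
      Measure.map_map (by fun_prop) (by fun_prop)]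
    congr 1
    funext ω
    refine Prod.ext ?_ rfl
    exact congrFun hres ω

end IsLevyProcess

section RealFunctions

/-- A multiplicative function on `[0, ∞)` with values in `[0, 1]` that tends to `1` at `0` is
exponential. -/
lemma exists_eq_exp_neg_of_mul {q : ℝ → ℝ} (hq0 : ∀ t, 0 ≤ q t) (hq1 : ∀ t, q t ≤ 1)
    (hmul : ∀ s t, 0 ≤ s → 0 ≤ t → q (s + t) = q s * q t)
    (hlim : Tendsto q (𝓝[≥] 0) (𝓝 1)) : ∃ a, 0 ≤ a ∧ ∀ t, 0 ≤ t → q t = Real.exp (-(a * t)) := by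
  have hpow (n : ℕ) (t : ℝ) (ht : 0 ≤ t) (hzero : q 0 = 1) : q (n * t) = q t ^ n := by
    induction n with
    | zero => simpa using hzero
    | succ n ih =>
      rw [Nat.cast_succ, add_one_mul, hmul _ _ (by positivity) ht, ih, pow_succ]
  have hzero : q 0 = 1 := tendsto_nhds_unique
    (tendsto_pure_nhds q 0 |>.mono_right le_rfl) (hlim.mono_left (by
      exact pure_le_nhdsWithin (Set.mem_Ici.2 le_rfl)))
  have hpos (t : ℝ) (ht : 0 ≤ t) : 0 < q t := by
    have hdiv : Tendsto (fun n : ℕ => t / n) atTop (𝓝[≥] 0) :=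
      tendsto_nhdsWithin_of_tendsto_nhds_of_eventually_within _
        (tendsto_const_div_atTop_nhds_zero_nat t) (Eventually.of_forall fun n => by
          exact div_nonneg ht n.cast_nonneg)
    obtain ⟨n, hn, hn0⟩ := (((hlim.comp hdiv).eventually (lt_mem_nhds one_pos)).and
      (eventually_gt_atTop 0)).exists
    have := hpow n (t / n) (by positivity) hzero
    rw [mul_div_cancel₀ _ (by positivity)] at this
    rw [this]
    exact pow_pos hn n
  set L : ℝ → ℝ := fun t => -Real.log (q t) with hL
  have hLadd (s t : ℝ) (hs : 0 ≤ s) (ht : 0 ≤ t) : L (s + t) = L s + L t := by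
    simp only [hL, hmul s t hs ht, Real.log_mul (hpos s hs).ne' (hpos t ht).ne', neg_add]
  have hLnn (t : ℝ) : 0 ≤ L t := neg_nonneg.2 (Real.log_nonpos (hq0 t) (hq1 t))
  have hLmono (s t : ℝ) (hs : 0 ≤ s) (hst : s ≤ t) : L s ≤ L t := by
    have := hLadd s (t - s) hs (sub_nonneg.2 hst)
    rw [add_sub_cancel] at this
    linarith [hLnn (t - s)]
  have hLnat (n : ℕ) (t : ℝ) (ht : 0 ≤ t) : L (n * t) = n * L t := by
    simp only [hL, hpow n t ht hzero, Real.log_pow, mul_neg]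
  have hLlin (t : ℝ) (ht : 0 ≤ t) : L t = L 1 * t := by
    have hbound (n : ℕ) : n * |L t - L 1 * t| ≤ L 1 := by
      have hlo := hLmono (⌊n * t⌋₊ * 1) (n * t) (by positivity)
        (by simpa using Nat.floor_le (by positivity : 0 ≤ n * t))
      have hhi := hLmono (n * t) ((⌊n * t⌋₊ + 1 : ℕ) * 1) (by positivity)
        (by simpa using (Nat.lt_floor_add_one (n * t)).le)
      rw [hLnat _ _ zero_le_one, hLnat _ _ ht] at hlo hhi
      have h1 := mul_le_mul_of_nonneg_right (Nat.floor_le (by positivity : 0 ≤ n * t)) (hLnn 1)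
      have h2 := mul_le_mul_of_nonneg_right (Nat.lt_floor_add_one (n * t)).le (hLnn 1)
      push_cast at hhi
      rw [← Nat.abs_cast n, ← abs_mul, abs_le]
      constructor <;> nlinarith
    by_contra hne
    obtain ⟨n, hn⟩ := Archimedean.arch (L 1 + 1) (abs_pos.2 (sub_ne_zero.2 hne))
    rw [nsmul_eq_mul] at hn
    linarith [hbound n]
  refine ⟨L 1, hLnn 1, fun t ht => ?_⟩
  rw [← hLlin t ht, hL, neg_neg, Real.exp_log (hpos t ht)]

lemma tendsto_nat_mul_one_sub_exp (c : ℝ) :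
    Tendsto (fun m : ℕ => (m : ℝ) * (1 - Real.exp (-(c / m)))) atTop (𝓝 c) := by
  have hd : HasDerivAt (fun x : ℝ => 1 - Real.exp (-(c * x))) c 0 := by
    have := (((hasDerivAt_id (0 : ℝ)).const_mul c).neg.exp).const_sub 1
    simpa using this
  have hinv : Tendsto (fun m : ℕ => (m : ℝ)⁻¹) atTop (𝓝[≠] 0) :=
    (tendsto_inv_atTop_nhdsGT_zero.comp tendsto_natCast_atTop_atTop).mono_right
      (nhdsWithin_mono _ fun _ h => ne_of_gt h)
  refine (hd.tendsto_slope_zero.comp hinv).congr fun m => ?_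
  simp [div_eq_mul_inv]

end RealFunctions

section Bernoulli

variable {Ω : Type*} [MeasurableSpace Ω] {P : Measure Ω} [IsProbabilityMeasure P]

/-- The number of successes among `j` trials, each successful with probability `p` independently
of the previous ones, has the binomial distribution. -/
lemma measureReal_eq_choose_of_indep {S : ℕ → Ω → ℕ} {A : ℕ → Set Ω} {p : ℝ}
    (hA : ∀ j, MeasurableSet (A j)) (hS : ∀ j, Measurable (S j)) (h0 : ∀ ω, S 0 ω = 0)
    (hA0 : ∀ j, ∀ ω ∉ A j, S (j + 1) ω = S j ω) (hA1 : ∀ j, ∀ ω ∈ A j, S (j + 1) ω = S j ω + 1)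
    (hind : ∀ j k, P.real ({ω | S j ω = k} ∩ A j) = P.real {ω | S j ω = k} * p) (j k : ℕ) :
    P.real {ω | S j ω = k} = j.choose k * p ^ k * (1 - p) ^ (j - k) := by
  have hdiff (j k : ℕ) : P.real ({ω | S j ω = k} \ A j) = P.real {ω | S j ω = k} * (1 - p) := by
    have := measureReal_inter_add_sdiff (μ := P) (s := {ω | S j ω = k}) (hA j)
    rw [hind] at this
    linarith
  induction j generalizing k with
  | zero => cases k <;> simp [h0]
  | succ j ih =>
    cases k with
    | zero =>
      have : {ω | S (j + 1) ω = 0} = {ω | S j ω = 0} \ A j := by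
        ext ω
        by_cases h : ω ∈ A j
        · simp [h, hA1 j ω h]
        · simp [h, hA0 j ω h]
      rw [this, hdiff, ih]
      simp [pow_succ]
    | succ k =>
      have : {ω | S (j + 1) ω = k + 1} = {ω | S j ω = k + 1} \ A j ∪ {ω | S j ω = k} ∩ A j := by
        ext ω
        by_cases h : ω ∈ A j
        · simp [h, hA1 j ω h]
        · simp [h, hA0 j ω h]
      have hm : MeasurableSet ({ω | S j ω = k} ∩ A j) :=
        (hS j (measurableSet_singleton k)).inter (hA j)
      rw [this, measureReal_union (Set.disjoint_left.2 fun ω h h' => h.2 h'.2) hm, hdiff, hind, ih, ih,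
        Nat.choose_succ_succ, Nat.add_sub_add_right]
      push_cast
      rcases lt_or_ge k j with hkj | hkj
      · rw [show j - k = j - (k + 1) + 1 by omega]
        ring
      · rw [Nat.choose_eq_zero_of_lt (Nat.lt_succ_of_le hkj)]
        simp [pow_succ]
        ring

end Bernoulli

section Poisson

variable {Ω : Type*} [MeasurableSpace Ω] {P : Measure Ω} {J : Ω → Set ℝ}

/-- A Lévy process counting the points of a random set is a Poisson process. -/
lemma IsLevyR.exists_measure_ncard_eq
    (hN : IsLevyR P fun t ω => ((J ω ∩ Set.Ioc 0 t).ncard : ℝ))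
    (hJ : ∀ ω t, (J ω ∩ Set.Ioc 0 t).Finite) :
    ∃ a : ℝ, 0 ≤ a ∧ ∀ t : ℝ, 0 ≤ t → ∀ k : ℕ,
      P {ω | ((J ω ∩ Set.Ioc 0 t).ncard : ℝ) = k} =
        ENNReal.ofReal ((a * t) ^ k * Real.exp (-(a * t)) / k.factorial) := by
  have := hN.isProb
  set N : ℝ → Ω → ℝ := fun t ω => ((J ω ∩ Set.Ioc 0 t).ncard : ℝ) with hNdef
  have hmN (t : ℝ) : Measurable (N t) := hN.meas t
  have hinc {s t : ℝ} (ht : 0 ≤ t) (hst : t ≤ s) (ω : Ω) :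
      N s ω - N t ω = (J ω ∩ Set.Ioc t s).ncard := by
    simp only [hNdef]
    rw [sub_eq_iff_eq_add']
    exact_mod_cast (ncard_inter_Ioc_add (hJ ω) le_rfl ht hst).symm
  set q : ℝ → ℝ := fun t => P.real {ω | N t ω = 0} with hq
  have hstat {s t : ℝ} (hs : 0 ≤ s) (ht : 0 ≤ t) :
      P.real {ω | N (t + s) ω - N t ω = 0} = q s := by
    have h := congrArg (fun μ : Measure ℝ => μ.real {0}) (hN.stat s t hs ht)
    have hm : Measurable fun ω => N (t + s) ω - N t ω := (hmN _).sub (hmN _)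
    rwa [map_measureReal_apply hm (measurableSet_singleton 0),
      map_measureReal_apply (hmN _) (measurableSet_singleton 0)] at h
  have hind {s t : ℝ} (hs : 0 ≤ s) (ht : 0 ≤ t)
      {W : ({r : ℝ // 0 ≤ r ∧ r ≤ t} → ℝ) → ℕ} (hW : Measurable W) (k : ℕ) :
      P.real ({ω | W (fun r => N r ω) = k} ∩ {ω | N (t + s) ω - N t ω = 0}) =
        P.real {ω | W (fun r => N r ω) = k} * q s := by
    have h := (hN.indep s t hs ht).measure_inter_preimage_eq_mul {0} (W ⁻¹' {k})
      (measurableSet_singleton 0) (hW (measurableSet_singleton k))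
    rw [← hstat hs ht, mul_comm, Set.inter_comm]
    exact (congrArg ENNReal.toReal h).trans ENNReal.toReal_mul
  have hmul (s t : ℝ) (hs : 0 ≤ s) (ht : 0 ≤ t) : q (s + t) = q s * q t := by
    have h := hind ht hs (W := fun w => if w ⟨s, hs, le_rfl⟩ = 0 then 0 else 1)
      (Measurable.ite ((measurable_pi_apply _) (measurableSet_singleton 0))
        measurable_const measurable_const) 0
    simp only [ite_eq_left_iff, one_ne_zero, imp_false, not_not] at h
    refine (congrArg P.real (Set.ext fun ω => ?_)).trans h
    have hnn : 0 ≤ N (s + t) ω - N s ω := by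
      rw [hinc hs (by linarith)]; positivity
    have hnn' : 0 ≤ N s ω := Nat.cast_nonneg _
    simp only [Set.mem_ofPred_eq, Set.mem_inter_iff]
    constructor
    · intro h0
      constructor <;> linarith
    · rintro ⟨h1, h2⟩
      linarith
  have hlim : Tendsto q (𝓝[≥] 0) (𝓝 1) := by
    have h := hN.contProb 0 le_rfl 1 one_pos
    have h' : Tendsto (fun s => 1 - P.real {ω | 1 ≤ |N s ω - N 0 ω|}) (𝓝[≥] 0) (𝓝 (1 - 0)) :=
      ((ENNReal.tendsto_toReal ENNReal.zero_ne_top).comp h).const_sub 1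
    rw [sub_zero] at h'
    refine h'.congr fun s => ?_
    rw [← probReal_compl_eq_one_sub]
    · refine congrArg P.real (Set.ext fun ω => ?_)
      have h0 : N 0 ω = 0 := by simp [hNdef]
      simp only [Set.mem_compl_iff, Set.mem_ofPred_eq, h0, sub_zero, not_le]
      simp only [hNdef, Nat.abs_cast, Nat.cast_lt_one, Nat.cast_eq_zero]
    · exact measurableSet_le measurable_const ((hmN s).sub (hmN 0)).abs
  obtain ⟨a, ha, hqa⟩ := exists_eq_exp_neg_of_mul (q := q) (fun t => measureReal_nonneg)
    (fun t => measureReal_le_one) hmul hlim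
  refine ⟨a, ha, fun t ht k => ?_⟩
  let Z : ℝ → ℕ := fun x => if x = 0 then 0 else 1
  have hZ : Measurable Z := Measurable.ite (measurableSet_singleton 0) measurable_const
    measurable_const
  let S : ℝ → ℕ → Ω → ℕ := fun h j ω =>
    ∑ i ∈ Finset.range j, Z (N ((i + 1 : ℕ) * h) ω - N (i * h) ω)
  have hS (h : ℝ) (j : ℕ) : Measurable (S h j) :=
    Finset.measurable_sum _ fun i _ => hZ.comp ((hmN _).sub (hmN _))
  have hbinom (h : ℝ) (hh : 0 ≤ h) (j k : ℕ) :
      P.real {ω | S h j ω = k} = j.choose k * (1 - q h) ^ k * (1 - (1 - q h)) ^ (j - k) := by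
    have hAm (j : ℕ) : MeasurableSet {ω | N ((j + 1 : ℕ) * h) ω - N (j * h) ω = 0} :=
      ((hmN _).sub (hmN _)) (measurableSet_singleton 0)
    refine measureReal_eq_choose_of_indep (S := S h)
      (A := fun j => {ω | N ((j + 1 : ℕ) * h) ω - N (j * h) ω = 0}ᶜ) (fun j => (hAm j).compl) (hS h)
      (fun ω => rfl) (fun j ω hω => ?_) (fun j ω hω => ?_) (fun j k => ?_) j k
    · rw [Set.notMem_compl_iff, Set.mem_ofPred_eq] at hω
      simp only [S, Finset.sum_range_succ, Z, hω, if_true, add_zero]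
    · rw [Set.mem_compl_iff, Set.mem_ofPred_eq] at hω
      simp only [S, Finset.sum_range_succ, Z, hω, if_false]
    · have hle {i : ℕ} (hi : i ≤ j) : (i : ℝ) * h ≤ j * h := by gcongr
      have key := hind hh (t := j * h) (by positivity)
        (W := fun w => ∑ i : Fin j, Z (w ⟨(i + 1 : ℕ) * h, by positivity, hle i.2⟩ -
          w ⟨i * h, by positivity, hle i.2.le⟩))
        (Finset.measurable_sum _ fun i _ => hZ.comp (by fun_prop)) k
      have hSsum (ω : Ω) : ∑ i : Fin j, Z (N ((i + 1 : ℕ) * h) ω - N (i * h) ω) = S h j ω :=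
        Fin.sum_univ_eq_sum_range (fun i => Z (N ((i + 1 : ℕ) * h) ω - N (i * h) ω)) j
      simp only [hSsum] at key
      have hadd := measureReal_inter_add_sdiff (μ := P) (s := {ω | S h j ω = k}) (hAm j)
      rw [← add_one_mul, ← Nat.cast_succ] at key
      rw [← Set.sdiff_eq]
      linarith
  have hconv : Tendsto (fun m : ℕ => P {ω | S (t / m) m ω = k}) atTop
      (𝓝 (P {ω | N t ω = (k : ℝ)})) := by
    refine tendsto_measure_of_tendsto_indicator_of_isFiniteMeasure atTop P
      (fun m => hS _ m (measurableSet_singleton k)) fun ω => ?_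
    filter_upwards [eventually_sum_min_one_ncard (hJ ω) le_rfl ht] with m hm
    have hterm (i : ℕ) : Z (N ((i + 1 : ℕ) * (t / m)) ω - N (i * (t / m)) ω) =
        min 1 (J ω ∩ Set.Ioc (i * (t / m)) ((i + 1 : ℕ) * (t / m))).ncard := by
      rw [hinc (by positivity) (by gcongr; simp)]
      simp only [Z, Nat.cast_eq_zero]
      split_ifs <;> omega
    simp only [zero_add] at hm
    have hsum : S (t / m) m ω = (J ω ∩ Set.Ioc 0 t).ncard :=
      (Finset.sum_congr rfl fun i _ => hterm i).trans hm
    rw [hsum]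
    exact Nat.cast_inj.symm
  have hlimit : Tendsto (fun m : ℕ => P.real {ω | S (t / m) m ω = k}) atTop
      (𝓝 (Real.exp (-(a * t)) * (a * t) ^ k / k.factorial)) := by
    refine (tendsto_choose_mul_pow_of_tendsto_mul_atTop k
      (tendsto_nat_mul_one_sub_exp (a * t))).congr fun m => ?_
    rw [hbinom _ (by positivity), hqa _ (by positivity), mul_div_assoc]
  have heq := tendsto_nhds_unique hlimit
    ((ENNReal.tendsto_toReal (measure_ne_top P _)).comp hconv)
  rw [← ENNReal.ofReal_toReal (measure_ne_top P {ω | N t ω = (k : ℝ)}), ← heq, mul_comm]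

end Poisson

lemma IsCadlag.measurable_toPath {Ω E : Type*} [MeasurableSpace Ω] [NormedAddCommGroup E]
    [MeasurableSpace E] {Y : ℝ → Ω → E} (hY : ∀ u, 0 ≤ u → Measurable (Y u))
    (hcad : ∀ ω, IsCadlag fun u => Y u ω) : Measurable fun ω => (hcad ω).toPath :=
  Measurable.subtype_mk (measurable_pi_lambda _ fun u : NNReal => hY u u.2)

namespace IsLevyProcess

variable {Ω : Type*} [MeasurableSpace Ω] {P : Measure Ω} {n : ℕ}
  {X : ℝ → Ω → EuclideanSpace ℝ (Fin n)} {B : Set (EuclideanSpace ℝ (Fin n))} {t : ℝ}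

lemma indepFun_shift (hX : IsLevyProcess P X) (hcad : ∀ ω, IsCadlag fun u => X u ω)
    (ht : 0 ≤ t) :
    IndepFun (fun ω => ((hcad ω).shift ht).toPath)
      (fun ω => fun r : {r : ℝ // 0 ≤ r ∧ r ≤ t} => X r ω) P := by
  have := hX.isProb
  have hmX := hX.meas
  have hQ : Measurable fun ω => fun r : {r : ℝ // 0 ≤ r ∧ r ≤ t} => X r ω :=
    measurable_pi_lambda _ fun r => hX.meas _
  refine indepFun_subtype (IndepFun.process_indepFun
    (X := fun (u : NNReal) ω => X (t + u) ω - X t ω) (fun u => (hmX _).sub (hmX _)) hQ fun I => ?_)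
  have hV : Measurable fun ω => I.restrict fun u : NNReal => X (t + u) ω - X t ω :=
    measurable_pi_lambda _ fun u => (hmX _).sub (hmX _)
  have hP : IsProbabilityMeasure
      (P.map fun ω => fun r : {r : ℝ // 0 ≤ r ∧ r ≤ t} => X r ω) :=
    Measure.isProbabilityMeasure_map hQ.aemeasurable
  have h := hX.map_restrict_shift_past ht I
  have hfst := congrArg (Measure.map Prod.fst) h
  rw [Measure.map_map measurable_fst (hV.prodMk hQ), Measure.map_fst_prod, measure_univ,
    one_smul] at hfst
  rw [← hfst] at h
  exact (indepFun_iff_map_prod_eq_prod_map_map hV.aemeasurable hQ.aemeasurable).2 h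

lemma map_shift (hX : IsLevyProcess P X) (hcad : ∀ ω, IsCadlag fun u => X u ω) (ht : 0 ≤ t) :
    P.map (fun ω => ((hcad ω).shift ht).toPath) = P.map fun ω => (hcad ω).toPath := by
  have := hX.isProb
  have hmX := hX.meas
  refine map_subtype_ext (IsCadlag.measurable_toPath (Y := fun u ω => X (t + u) ω - X t ω)
    (fun u _ => (hmX _).sub (hmX _)) _) (IsCadlag.measurable_toPath (fun u _ => hmX u) _) ?_
  refine (map_eq_iff_forall_finset_map_restrict_eq
    (X := fun (u : NNReal) ω => X (t + u) ω - X t ω) (Y := fun (u : NNReal) ω => X u ω)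
    (measurable_pi_lambda _ fun u => (hmX _).sub (hmX _)).aemeasurable
    (measurable_pi_lambda _ fun u => hmX _).aemeasurable).2 fun I => ?_
  have hQ : Measurable fun ω => fun r : {r : ℝ // 0 ≤ r ∧ r ≤ t} => X r ω :=
    measurable_pi_lambda _ fun r => hX.meas _
  have hV : Measurable fun ω => I.restrict fun u : NNReal => X (t + u) ω - X t ω :=
    measurable_pi_lambda _ fun u => (hmX _).sub (hmX _)
  have hP : IsProbabilityMeasure
      (P.map fun ω => fun r : {r : ℝ // 0 ≤ r ∧ r ≤ t} => X r ω) :=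
    Measure.isProbabilityMeasure_map hQ.aemeasurable
  have hfst := congrArg (Measure.map Prod.fst) (hX.map_restrict_shift_past ht I)
  rwa [Measure.map_map measurable_fst (hV.prodMk hQ), Measure.map_fst_prod, measure_univ,
    one_smul] at hfst

/-- The process counting the jumps of a càdlàg Lévy process in a set away from `0` is a Lévy
process. -/
lemma isLevyR_ncard_jumpTimes (hX : IsLevyProcess P X) (hcad : ∀ ω, IsCadlag fun u => X u ω)
    (hB : MeasurableSet B) (hB0 : (0 : EuclideanSpace ℝ (Fin n)) ∉ closure B) :
    IsLevyR P fun t ω => ((jumpTimes (fun u => X u ω) B ∩ Set.Ioc 0 t).ncard : ℝ) := by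
  have := hX.isProb
  let C : ℝ → CadlagPath (EuclideanSpace ℝ (Fin n)) → ℝ :=
    fun t y => ((jumpTimes y.path B ∩ Set.Ioc 0 t).ncard : ℝ)
  have hC (t : ℝ) : Measurable (C t) :=
    measurable_from_top.comp (CadlagPath.measurable_ncard hB hB0 t)
  set N : ℝ → Ω → ℝ := fun t ω => ((jumpTimes (fun u => X u ω) B ∩ Set.Ioc 0 t).ncard : ℝ)
    with hNdef
  have hNC (t : ℝ) : N t = fun ω => C t (hcad ω).toPath := by
    simp only [N, C, IsCadlag.jumpTimes_toPath]
  have hpath : Measurable fun ω => (hcad ω).toPath := IsCadlag.measurable_toPath (fun u _ => hX.meas u) hcad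
  have hshift {t : ℝ} (ht : 0 ≤ t) : Measurable fun ω => ((hcad ω).shift ht).toPath :=
    IsCadlag.measurable_toPath (Y := fun u ω => X (t + u) ω - X t ω)
      (fun u _ => (hX.meas _).sub (hX.meas _)) _
  have hinc {s t : ℝ} (hs : 0 ≤ s) (ht : 0 ≤ t) :
      (fun ω => N (t + s) ω - N t ω) = fun ω => C s ((hcad ω).shift ht).toPath := by
    funext ω
    have h := ncard_inter_Ioc_add (fun r => (hcad ω).finite_jumpTimes hB0 r) le_rfl ht
      (le_add_of_nonneg_right hs)
    simp only [N, C, IsCadlag.jumpTimes_toPath]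
    rw [(hcad ω).ncard_jumpTimes_shift ht, sub_eq_iff_eq_add']
    exact_mod_cast h.symm
  have hmeas (t : ℝ) : Measurable (N t) := by
    rw [hNC]
    exact (hC t).comp hpath
  have hstat (s t : ℝ) (hs : 0 ≤ s) (ht : 0 ≤ t) :
      P.map (fun ω => N (t + s) ω - N t ω) = P.map (N s) := by
    have h1 := Measure.map_map (μ := P) (hC s) (hshift ht)
    have h2 := Measure.map_map (μ := P) (hC s) hpath
    rw [hinc hs ht, hNC s]
    exact h1.symm.trans ((congrArg (Measure.map (C s)) (hX.map_shift hcad ht)).trans h2)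
  refine ⟨this, hmeas, Eventually.of_forall fun ω => by simp [N], fun s t hs ht => ?_, hstat,
    fun t ht ε hε => ?_⟩
  · rw [hinc hs ht]
    have h := (hX.indepFun_shift hcad ht).comp (hC s) measurable_id
    rw [IndepFun_iff_Indep] at h ⊢
    refine indep_of_indep_of_le_right h ?_
    let past : Ω → {r : ℝ // 0 ≤ r ∧ r ≤ t} → EuclideanSpace ℝ (Fin n) := fun ω r => X r ω
    let m : MeasurableSpace Ω := MeasurableSpace.comap past inferInstance
    have hpast : Measurable[m] fun ω => ((hcad ω).comp_min ht).toPath := by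
      refine IsCadlag.measurable_toPath (Y := fun u ω => X (min u t) ω) (fun u hu => ?_) _
      exact (measurable_pi_apply ⟨min u t, le_min hu ht, min_le_right u t⟩).comp
        (comap_measurable past)
    refine Measurable.comap_le (m₁ := m) (measurable_pi_lambda _ fun r => ?_)
    have : N r = fun ω => C r ((hcad ω).comp_min ht).toPath := by
      funext ω
      simp only [N, C, IsCadlag.jumpTimes_toPath]
      congr 2
      ext v
      simp only [Set.mem_inter_iff, and_congr_left_iff]
      intro hv
      refine mem_jumpTimes_congr fun u _ hu => ?_
      rw [min_eq_left (hu.trans (hv.2.trans r.2.2))]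
    rw [this]
    exact (hC r).comp hpast
  · have hzero : Tendsto (fun h : ℝ => P {ω | ε ≤ |N h ω|}) (𝓝[≥] 0) (𝓝 0) := by
      rw [← measure_empty (μ := P)]
      refine tendsto_measure_of_tendsto_indicator_of_isFiniteMeasure _ P
        (fun h => measurableSet_le measurable_const (hmeas h).abs) fun ω => ?_
      obtain ⟨b, hb, hbJ⟩ := mem_nhdsGT_iff_exists_Ioo_subset.1
        ((hcad ω).eventually_right_notMem hB0 le_rfl)
      filter_upwards [Ico_mem_nhdsGE hb] with h hh
      have : jumpTimes (fun u => X u ω) B ∩ Set.Ioc 0 h = ∅ :=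
        Set.eq_empty_of_forall_notMem fun u hu => hbJ ⟨hu.2.1, hu.2.2.trans_lt hh.2⟩ hu.1
      simp [N, this, hε]
    have hdiff (s : ℝ) (hs : 0 ≤ s) :
        P {ω | ε ≤ |N s ω - N t ω|} = P {ω | ε ≤ |N |s - t| ω|} := by
      have key {s t : ℝ} (ht : 0 ≤ t) (hts : t ≤ s) :
          P {ω | ε ≤ |N s ω - N t ω|} = P {ω | ε ≤ |N (s - t) ω|} := by
        have h := congrArg (fun μ : Measure ℝ => μ {x | ε ≤ |x|})
          (hstat (s - t) t (sub_nonneg.2 hts) ht)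
        have hm : MeasurableSet {x : ℝ | ε ≤ |x|} :=
          measurableSet_le measurable_const measurable_id.abs
        rw [add_sub_cancel] at h
        have hmd : Measurable fun ω => N s ω - N t ω := (hmeas s).sub (hmeas t)
        rwa [Measure.map_apply hmd hm, Measure.map_apply (hmeas _) hm] at h
      rcases le_total t s with hts | hst
      · rw [key ht hts, abs_of_nonneg (sub_nonneg.2 hts)]
      · simp_rw [abs_sub_comm (N s _), abs_sub_comm s]
        rw [key hs hst, abs_of_nonneg (sub_nonneg.2 hst)]
    have habs : Tendsto (fun s => |s - t|) (𝓝[Set.Ici 0] t) (𝓝[≥] 0) := by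
      refine tendsto_nhdsWithin_of_tendsto_nhds_of_eventually_within _ ?_
        (Eventually.of_forall fun s => Set.mem_Ici.2 (abs_nonneg _))
      have : Continuous fun s : ℝ => |s - t| := (continuous_id.sub continuous_const).abs
      simpa using (this.tendsto t).mono_left nhdsWithin_le_nhds
    refine (hzero.comp habs).congr' ?_
    filter_upwards [self_mem_nhdsWithin] with s hs using (hdiff s hs).symm

end IsLevyProcess

/-- for a càdlàg Lévy process `X` and a Borel set `B` with
`0 ∉ closure B`, the number of jumps in `B` up to time `t` is a.s. finite, and the
counting process `N_t(B)` is a Poisson process. -/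
theorem jump_counting_is_poisson {Ω : Type*} [MeasurableSpace Ω] (P : Measure Ω) {n : ℕ}
    (X Xm : ℝ → Ω → EuclideanSpace ℝ (Fin n)) (hX : IsLevyProcess P X)
    (hrc : ∀ ω, ∀ t : ℝ, 0 ≤ t → ContinuousWithinAt (fun s => X s ω) (Set.Ici t) t)
    (hll : ∀ ω, ∀ t : ℝ, 0 < t →
      Tendsto (fun s => X s ω) (𝓝[Set.Iio t] t) (𝓝 (Xm t ω)))
    (B : Set (EuclideanSpace ℝ (Fin n))) (hB : MeasurableSet B)
    (hB0 : (0 : EuclideanSpace ℝ (Fin n)) ∉ closure B) :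
    letI NB : ℝ → Ω → ℝ :=
      fun t ω => (Set.ncard {s : ℝ | 0 < s ∧ s ≤ t ∧ X s ω - Xm s ω ∈ B} : ℝ)
    (∀ t : ℝ, 0 ≤ t →
      ∀ᵐ ω ∂P, {s : ℝ | 0 < s ∧ s ≤ t ∧ X s ω - Xm s ω ∈ B}.Finite) ∧
    IsLevyR P NB ∧
    ∃ a : ℝ, 0 ≤ a ∧ ∀ t : ℝ, 0 ≤ t → ∀ k : ℕ,
      P {ω | NB t ω = (k : ℝ)}
        = ENNReal.ofReal ((a * t) ^ k * Real.exp (-(a * t)) / k.factorial) := by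
  have hcad (ω : Ω) : IsCadlag fun u => X u ω := ⟨hrc ω, fun t ht => ⟨Xm t ω, hll ω t ht⟩⟩
  have hset (t : ℝ) (ω : Ω) : {s : ℝ | 0 < s ∧ s ≤ t ∧ X s ω - Xm s ω ∈ B} =
      jumpTimes (fun u => X u ω) B ∩ Set.Ioc 0 t := by
    ext s
    constructor
    · rintro ⟨h0, hst, hs⟩
      exact ⟨(mem_jumpTimes_iff h0 (hll ω s h0)).2 hs, h0, hst⟩
    · rintro ⟨hs, h0, hst⟩
      exact ⟨h0, hst, (mem_jumpTimes_iff h0 (hll ω s h0)).1 hs⟩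
  have hfin (ω : Ω) (t : ℝ) := (hcad ω).finite_jumpTimes hB0 t
  have hN := hX.isLevyR_ncard_jumpTimes hcad hB hB0
  simp only [hset]
  exact ⟨fun t _ => Eventually.of_forall fun ω => hfin ω t, hN, hN.exists_measure_ncard_eq hfin⟩
end
end
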